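/- arXiv:1710.08811 — 2 statements merged into one kernel-verified Lean document; each statement's English description precedes it below -/
import Mathlib

section
/- For every i ∈ {1,…,N}, one has λ_ε f_ε(x_{i,ε}) γ_{i,ε}² d_{i,ε}² ≤ 4 for all ε small enough, where d_{i,ε} = d(x_{i,ε}, ∂Ω). -/
open Metric Set Filter Topology Real MeasureTheory
open scoped RealInnerProductSpace

noncomputable section

/-- Points of the plane. -/
abbrev Pt := EuclideanSpace ℝ (Fin 2)

/-- The geometer's Laplacian `Δu = -(∂²u/∂x² + ∂²u/∂y²)`. -/
def lap (u : Pt → ℝ) (x : Pt) : ℝ :=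
  - ∑ i : Fin 2, fderiv ℝ (fun y => fderiv ℝ u y (EuclideanSpace.single i 1)) x
      (EuclideanSpace.single i 1)

/-- Convergence in `C^k(s)`: uniform convergence on `s` of all derivatives of order `≤ k`. -/
def TendstoCkOn (F : ℕ → Pt → ℝ) (g : Pt → ℝ) (s : Set Pt) (k : ℕ) : Prop :=
  ∀ j : ℕ, j ≤ k → TendstoUniformlyOn (fun n x => iteratedFDeriv ℝ j (F n) x)
    (fun x => iteratedFDeriv ℝ j g x) atTop s

/-- Convergence in `C^k_loc(s)`: locally uniform convergence on `s` of all derivatives of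
order `≤ k`. -/
def TendstoCkLocOn (F : ℕ → Pt → ℝ) (g : Pt → ℝ) (s : Set Pt) (k : ℕ) : Prop :=
  ∀ j : ℕ, j ≤ k → TendstoLocallyUniformlyOn (fun n x => iteratedFDeriv ℝ j (F n) x)
    (fun x => iteratedFDeriv ℝ j g x) atTop s

/-- The standard bubble profile `U(x) = -ln(1 + |x|²/4)`. -/
def Ustd (x : Pt) : ℝ := - Real.log (1 + ‖x‖ ^ 2 / 4)

/-- The mean value over the circle of a function of the angle. -/
def cavg (h : ℝ → ℝ) : ℝ := (2 * π)⁻¹ * ∫ θ in (0 : ℝ)..(2 * π), h θ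

lemma cavg_add {f g : ℝ → ℝ} (hf : Continuous f) (hg : Continuous g) :
    cavg (fun θ => f θ + g θ) = cavg f + cavg g := by
  unfold cavg
  rw [intervalIntegral.integral_add (hf.intervalIntegrable _ _) (hg.intervalIntegrable _ _)]
  ring

lemma cavg_sub {f g : ℝ → ℝ} (hf : Continuous f) (hg : Continuous g) :
    cavg (fun θ => f θ - g θ) = cavg f - cavg g := by
  unfold cavg
  rw [intervalIntegral.integral_sub (hf.intervalIntegrable _ _) (hg.intervalIntegrable _ _)]
  ring

lemma cavg_const_mul (c : ℝ) (f : ℝ → ℝ) : cavg (fun θ => c * f θ) = c * cavg f := by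
  unfold cavg
  rw [intervalIntegral.integral_const_mul]
  ring

lemma cavg_neg (f : ℝ → ℝ) : cavg (fun θ => -f θ) = -cavg f := by
  unfold cavg
  rw [intervalIntegral.integral_neg]
  ring

lemma cavg_const (c : ℝ) : cavg (fun _ => c) = c := by
  unfold cavg
  rw [intervalIntegral.integral_const]
  have := Real.pi_pos
  simp
  field_simp

lemma cavg_mono {f g : ℝ → ℝ} (hf : Continuous f) (hg : Continuous g) (h : ∀ θ, f θ ≤ g θ) :
    cavg f ≤ cavg g := by
  unfold cavg
  have := Real.pi_pos
  apply mul_le_mul_of_nonneg_left _ (by positivity)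
  exact intervalIntegral.integral_mono_on (by positivity) (hf.intervalIntegrable _ _)
    (hg.intervalIntegrable _ _) (fun θ _ => h θ)

lemma cavg_nonneg {f : ℝ → ℝ} (h : ∀ θ, 0 ≤ f θ) : 0 ≤ cavg f := by
  unfold cavg
  have := Real.pi_pos
  exact mul_nonneg (by positivity)
    (intervalIntegral.integral_nonneg (by positivity) (fun θ _ => h θ))

lemma abs_cavg_le {f g : ℝ → ℝ} (hf : Continuous f) (hg : Continuous g) (h : ∀ θ, |f θ| ≤ g θ) :
    |cavg f| ≤ cavg g := by
  rw [abs_le]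
  constructor
  · rw [← cavg_neg]
    exact cavg_mono hg.neg hf (fun θ => by linarith [neg_abs_le (f θ), h θ])
  · exact cavg_mono hf hg (fun θ => (le_abs_self _).trans (h θ))

lemma cavg_cos : cavg cos = 0 := by simp [cavg]

lemma cavg_sin : cavg sin = 0 := by simp [cavg]

lemma cavg_cos_sq : cavg (fun θ => cos θ ^ 2) = 1 / 2 := by
  have := Real.pi_pos
  simp [cavg, integral_cos_sq]
  field_simp

lemma cavg_sin_sq : cavg (fun θ => sin θ ^ 2) = 1 / 2 := by
  have := Real.pi_pos
  simp [cavg, integral_sin_sq]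
  field_simp

lemma cavg_sin_mul_cos : cavg (fun θ => sin θ * cos θ) = 0 := by
  simp [cavg, integral_sin_mul_cos₁]

/-- Integration by parts on the circle. -/
lemma cavg_deriv_mul {w w' v v' : ℝ → ℝ} (hw : ∀ θ, HasDerivAt w (w' θ) θ) (hw' : Continuous w')
    (hv : ∀ θ, HasDerivAt v (v' θ) θ) (hv' : Continuous v')
    (hwp : w (2 * π) = w 0) (hvp : v (2 * π) = v 0) :
    cavg (fun θ => w' θ * v θ) = -cavg (fun θ => w θ * v' θ) := by
  unfold cavg
  have h := intervalIntegral.integral_deriv_mul_eq_sub (a := 0) (b := 2 * π) (u := w) (v := v)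
    (fun θ _ => hw θ) (fun θ _ => hv θ)
    (hw'.intervalIntegrable _ _) (hv'.intervalIntegrable _ _)
  have cw : Continuous w := continuous_iff_continuousAt.2 fun θ => (hw θ).continuousAt
  have cv : Continuous v := continuous_iff_continuousAt.2 fun θ => (hv θ).continuousAt
  have ha := intervalIntegral.integral_add (μ := volume) (a := 0) (b := 2 * π)
    (f := fun θ => w' θ * v θ) (g := fun θ => w θ * v' θ)
    ((hw'.mul cv).intervalIntegrable _ _) ((cw.mul hv').intervalIntegrable _ _)
  rw [ha, hwp, hvp, sub_self] at h
  rw [eq_neg_of_add_eq_zero_left h]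
  ring

/-- Expansion of the mean square of a function after removing its modes of order at most one. -/
lemma cavg_remainder_sq {w : ℝ → ℝ} (hw : Continuous w) (b p q : ℝ) :
    cavg (fun θ => (w θ - b - 2 * p * cos θ - 2 * q * sin θ) ^ 2)
      = cavg (fun θ => w θ ^ 2) - 2 * b * cavg w - 4 * p * cavg (fun θ => w θ * cos θ)
        - 4 * q * cavg (fun θ => w θ * sin θ) + b ^ 2 + 2 * p ^ 2 + 2 * q ^ 2 := by
  have e : (fun θ => (w θ - b - 2 * p * cos θ - 2 * q * sin θ) ^ 2) = fun θ =>
      w θ ^ 2 - (2 * b) * w θ - (4 * p) * (w θ * cos θ) - (4 * q) * (w θ * sin θ) + b ^ 2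
      + (4 * p ^ 2) * cos θ ^ 2 + (4 * q ^ 2) * sin θ ^ 2 + (4 * b * p) * cos θ
      + (4 * b * q) * sin θ + (8 * p * q) * (sin θ * cos θ) := by
    funext θ; ring
  rw [e]
  repeat rw [cavg_add (by fun_prop) (by fun_prop)]
  repeat rw [cavg_sub (by fun_prop) (by fun_prop)]
  simp only [cavg_const_mul, cavg_const, cavg_cos_sq, cavg_sin_sq, cavg_sin_mul_cos]
  have h1 : cavg (fun θ => cos θ) = 0 := cavg_cos
  have h2 : cavg (fun θ => sin θ) = 0 := cavg_sin
  rw [h1, h2]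
  ring

lemma cavg_bessel {w : ℝ → ℝ} (hw : Continuous w) :
    cavg w ^ 2 + 2 * cavg (fun θ => w θ * cos θ) ^ 2 + 2 * cavg (fun θ => w θ * sin θ) ^ 2
      ≤ cavg (fun θ => w θ ^ 2) := by
  have h := cavg_remainder_sq hw (cavg w) (cavg (fun θ => w θ * cos θ))
    (cavg (fun θ => w θ * sin θ))
  have h0 : 0 ≤ cavg (fun θ => (w θ - cavg w - 2 * cavg (fun θ => w θ * cos θ) * cos θ
      - 2 * cavg (fun θ => w θ * sin θ) * sin θ) ^ 2) := cavg_nonneg fun θ => sq_nonneg _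
  nlinarith

lemma fourierCoeffOn_circle (w : ℝ → ℝ) (hw : Continuous w) (n : ℤ) :
    fourierCoeffOn Real.two_pi_pos (fun θ => (w θ : ℂ)) n
      = (cavg (fun θ => w θ * cos (n * θ)) : ℂ) - Complex.I * cavg (fun θ => w θ * sin (n * θ)) := by
  rw [fourierCoeffOn_eq_integral]
  unfold cavg
  have e : ∀ θ : ℝ, (fourier (-n) (θ : AddCircle (2 * π - 0)) : ℂ) • (w θ : ℂ)
      = ((w θ * cos (n * θ) : ℝ) : ℂ) - Complex.I * ((w θ * sin (n * θ) : ℝ) : ℂ) := by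
    intro θ
    rw [fourier_coe_apply]
    have : (2 * π * Complex.I * ((-n : ℤ) : ℂ) * θ / ((2 * π - 0 : ℝ) : ℂ))
        = (-(n * θ) : ℂ) * Complex.I := by
      have := Real.pi_ne_zero
      push_cast
      have h2 : (π : ℂ) ≠ 0 := by exact_mod_cast this
      simp only [sub_zero]
      field_simp
    rw [this, Complex.exp_mul_I, Complex.cos_neg, Complex.sin_neg]
    push_cast
    simp only [smul_eq_mul]
    ring
  simp_rw [e]
  rw [intervalIntegral.integral_sub, intervalIntegral.integral_const_mul,
    intervalIntegral.integral_ofReal, intervalIntegral.integral_ofReal]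
  · simp only [sub_zero, one_div]
    rw [Complex.real_smul]
    push_cast
    ring
  · exact Continuous.intervalIntegrable (by fun_prop) _ _
  · exact Continuous.intervalIntegrable (by fun_prop) _ _

lemma hasSum_sq_circle (w : ℝ → ℝ) (hw : Continuous w) :
    HasSum (fun n : ℤ => cavg (fun θ => w θ * cos (n * θ)) ^ 2
      + cavg (fun θ => w θ * sin (n * θ)) ^ 2) (cavg (fun θ => w θ ^ 2)) := by
  have hL2 : MemLp (fun θ => (w θ : ℂ)) 2 (volume.restrict (Ioc 0 (2 * π))) := by
    have hc : Continuous (fun θ => (w θ : ℂ)) := by fun_prop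
    obtain ⟨K, hK⟩ := isCompact_Icc.exists_bound_of_continuousOn
      (hc.continuousOn (s := Icc 0 (2 * π)))
    refine MemLp.of_bound hc.aestronglyMeasurable K ?_
    rw [ae_restrict_iff' measurableSet_Ioc]
    exact ae_of_all _ fun θ hθ => hK θ (Ioc_subset_Icc_self hθ)
  have h := hasSum_sq_fourierCoeffOn Real.two_pi_pos hL2
  convert h using 1
  · funext n
    rw [fourierCoeffOn_circle w hw n, Complex.sq_norm, Complex.normSq_apply]
    simp
    ring
  · simp [cavg]

/-- Wirtinger's inequality for the modes of order at least two. -/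
lemma wirtinger_two {w w' : ℝ → ℝ} (hw : ∀ θ, HasDerivAt w (w' θ) θ) (hw' : Continuous w')
    (hp : w (2 * π) = w 0) :
    4 * (cavg (fun θ => w θ ^ 2) - cavg w ^ 2 - 2 * cavg (fun θ => w θ * cos θ) ^ 2
        - 2 * cavg (fun θ => w θ * sin θ) ^ 2)
      ≤ cavg (fun θ => w' θ ^ 2) - 2 * cavg (fun θ => w θ * cos θ) ^ 2
        - 2 * cavg (fun θ => w θ * sin θ) ^ 2 := by
  have cw : Continuous w := continuous_iff_continuousAt.2 fun θ => (hw θ).continuousAt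
  have hc : ∀ n : ℤ, cavg (fun θ => w' θ * cos (n * θ)) = n * cavg (fun θ => w θ * sin (n * θ)) := by
    intro n
    rw [cavg_deriv_mul hw hw' (v := fun θ => cos (n * θ)) (v' := fun θ => -sin (n * θ) * n)
      (fun θ => by simpa using ((hasDerivAt_id θ).const_mul (n : ℝ)).cos) (by fun_prop) hp
      (by simp), ← cavg_const_mul, ← cavg_neg]
    congr 1; funext θ; ring
  have hs : ∀ n : ℤ, cavg (fun θ => w' θ * sin (n * θ))
      = -(n * cavg (fun θ => w θ * cos (n * θ))) := by
    intro n
    rw [cavg_deriv_mul hw hw' (v := fun θ => sin (n * θ)) (v' := fun θ => cos (n * θ) * n)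
      (fun θ => by simpa using ((hasDerivAt_id θ).const_mul (n : ℝ)).sin) (by fun_prop) hp
      (by
        have := Real.sin_int_mul_pi (2 * n)
        push_cast at this
        rw [show (n : ℝ) * (2 * π) = 2 * n * π by ring, this]; simp), ← cavg_const_mul]
    congr 2; funext θ; ring
  have h1 := hasSum_sq_circle w cw
  have h2 := hasSum_sq_circle w' hw'
  set c : ℤ → ℝ := fun n => cavg (fun θ => w θ * cos (n * θ)) ^ 2
      + cavg (fun θ => w θ * sin (n * θ)) ^ 2 with hcdef
  have h2' : HasSum (fun n : ℤ => (n : ℝ) ^ 2 * c n) (cavg (fun θ => w' θ ^ 2)) := by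
    convert h2 using 1
    funext n
    rw [hc, hs, hcdef]; ring
  have h3 := h2'.sub (h1.mul_left 4)
  have h4 : ∑ n ∈ ({-1, 0, 1} : Finset ℤ), ((n : ℝ) ^ 2 * c n - 4 * c n)
      ≤ cavg (fun θ => w' θ ^ 2) - 4 * cavg (fun θ => w θ ^ 2) := by
    apply sum_le_hasSum _ _ h3
    intro n hn
    have hn' : 2 ≤ |n| := by
      simp only [Finset.mem_insert, Finset.mem_singleton, not_or] at hn
      rcases abs_cases n with h | h <;> omega
    have hcn : 0 ≤ c n := by positivity
    have : (4 : ℝ) ≤ (n : ℝ) ^ 2 := by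
      have : (2 : ℝ) ≤ |(n : ℝ)| := by exact_mod_cast hn'
      rw [← sq_abs]; nlinarith
    nlinarith
  have e1 : c 1 = cavg (fun θ => w θ * cos θ) ^ 2 + cavg (fun θ => w θ * sin θ) ^ 2 := by
    simp [hcdef]
  have e2 : c (-1) = cavg (fun θ => w θ * cos θ) ^ 2 + cavg (fun θ => w θ * sin θ) ^ 2 := by
    simp [hcdef, cavg_neg]
  have e3 : c 0 = cavg w ^ 2 := by
    have : cavg (fun _ => (0 : ℝ)) = 0 := cavg_const 0
    simp [hcdef, this]
  rw [Finset.sum_insert (by decide), Finset.sum_insert (by decide), Finset.sum_singleton, e1, e2,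
    e3] at h4
  push_cast at h4
  linarith

lemma continuous_slice {S : ℝ} {H : ℝ → ℝ → ℝ}
    (hH : ContinuousOn (Function.uncurry H) (Ioo (-S) S ×ˢ univ)) {r : ℝ} (hr : r ∈ Ioo (-S) S) :
    Continuous (H r) := by
  have : ContinuousOn (fun θ : ℝ => Function.uncurry H (r, θ)) univ :=
    hH.comp (by fun_prop) (fun θ _ => ⟨hr, mem_univ _⟩)
  exact continuousOn_univ.1 this

lemma continuousOn_cavg {S : ℝ} {H : ℝ → ℝ → ℝ}
    (hH : ContinuousOn (Function.uncurry H) (Ioo (-S) S ×ˢ univ)) :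
    ContinuousOn (fun r => cavg (H r)) (Ioo (-S) S) := by
  rw [continuousOn_iff_continuous_domRestrict]
  unfold cavg
  apply Continuous.mul continuous_const
  apply intervalIntegral.continuous_parametric_intervalIntegral_of_continuous'
    (f := fun (r : Ioo (-S) S) θ => H r θ)
  exact hH.comp_continuous (f := fun p : (Ioo (-S) S) × ℝ => ((p.1 : ℝ), p.2)) (by fun_prop)
    (fun p => ⟨p.1.2, mem_univ _⟩)

lemma hasDerivAt_cavg {S : ℝ} {H H' : ℝ → ℝ → ℝ}
    (hH : ContinuousOn (Function.uncurry H) (Ioo (-S) S ×ˢ univ))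
    (hH' : ContinuousOn (Function.uncurry H') (Ioo (-S) S ×ˢ univ))
    (hd : ∀ r ∈ Ioo (-S) S, ∀ θ, HasDerivAt (fun r => H r θ) (H' r θ) r)
    {r : ℝ} (hr : r ∈ Ioo (-S) S) :
    HasDerivAt (fun r => cavg (H r)) (cavg (H' r)) r := by
  obtain ⟨δ, hδ, hball⟩ := Metric.isOpen_iff.1 isOpen_Ioo r hr
  have hsub : Icc (r - δ / 2) (r + δ / 2) ⊆ Ioo (-S) S := by
    refine Subset.trans ?_ hball
    intro x hx
    rw [Metric.mem_ball, Real.dist_eq, abs_lt]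
    constructor <;> linarith [hx.1, hx.2]
  obtain ⟨K, hK⟩ := (isCompact_Icc.prod isCompact_Icc).exists_bound_of_continuousOn
    (hH'.mono (prod_mono hsub (subset_univ (Icc 0 (2 * π)))))
  unfold cavg
  apply HasDerivAt.const_mul
  refine (intervalIntegral.hasDerivAt_integral_of_dominated_loc_of_deriv_le
    (s := Ioo (r - δ / 2) (r + δ / 2)) (bound := fun _ => K)
    (Ioo_mem_nhds (by linarith) (by linarith)) ?_ ?_ ?_ ?_ ?_ ?_).2
  · filter_upwards [isOpen_Ioo.mem_nhds hr] with x hx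
    exact (continuous_slice hH hx).aestronglyMeasurable
  · exact (continuous_slice hH hr).intervalIntegrable _ _
  · exact (continuous_slice hH' hr).aestronglyMeasurable
  · refine ae_of_all _ fun θ hθ x hx => ?_
    rw [uIoc_of_le Real.two_pi_pos.le] at hθ
    exact hK (x, θ) ⟨Ioo_subset_Icc_self hx, Ioc_subset_Icc_self hθ⟩
  · exact intervalIntegrable_const
  · exact ae_of_all _ fun θ _ x hx => hd x (hsub (Ioo_subset_Icc_self hx)) θ

/-- A solution of `∂²V/∂r² + r⁻¹ ∂V/∂r + r⁻² ∂²V/∂θ² = -G` on the disc of radius `S` in polar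
coordinates, with the derivatives of `V` as data, vanishing with its gradient at the center. -/
structure PolarSolution (S : ℝ) (V Vr Vrr Vt Vtt G : ℝ → ℝ → ℝ) : Prop where
  hr : ∀ r ∈ Ioo (-S) S, ∀ θ, HasDerivAt (fun r => V r θ) (Vr r θ) r
  hrr : ∀ r ∈ Ioo (-S) S, ∀ θ, HasDerivAt (fun r => Vr r θ) (Vrr r θ) r
  ht : ∀ r ∈ Ioo (-S) S, ∀ θ, HasDerivAt (V r) (Vt r θ) θ
  htt : ∀ r ∈ Ioo (-S) S, ∀ θ, HasDerivAt (Vt r) (Vtt r θ) θ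
  cV : ContinuousOn (Function.uncurry V) (Ioo (-S) S ×ˢ univ)
  cVr : ContinuousOn (Function.uncurry Vr) (Ioo (-S) S ×ˢ univ)
  cVrr : ContinuousOn (Function.uncurry Vrr) (Ioo (-S) S ×ˢ univ)
  cVt : ContinuousOn (Function.uncurry Vt) (Ioo (-S) S ×ˢ univ)
  cVtt : ContinuousOn (Function.uncurry Vtt) (Ioo (-S) S ×ˢ univ)
  cG : ContinuousOn (Function.uncurry G) (Ioo (-S) S ×ˢ univ)
  per : ∀ r ∈ Ioo (-S) S, V r (2 * π) = V r 0
  pert : ∀ r ∈ Ioo (-S) S, Vt r (2 * π) = Vt r 0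
  pde : ∀ r ∈ Ioo (-S) S, ∀ θ, r ^ 2 * Vrr r θ + r * Vr r θ + Vtt r θ = -(r ^ 2 * G r θ)
  center : ∀ θ, V 0 θ = 0
  centerr : ∀ θ, Vr 0 θ = 0

namespace PolarSolution

variable {S : ℝ} {V Vr Vrr Vt Vtt G : ℝ → ℝ → ℝ}

section modes

variable {c c' : ℝ → ℝ}

lemma hasDerivAt_mode (h : PolarSolution S V Vr Vrr Vt Vtt G) (hc : Continuous c)
    {r : ℝ} (hr : r ∈ Ioo (-S) S) :
    HasDerivAt (fun r => cavg (fun θ => V r θ * c θ)) (cavg (fun θ => Vr r θ * c θ)) r :=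
  hasDerivAt_cavg (H := fun r θ => V r θ * c θ) (H' := fun r θ => Vr r θ * c θ)
    (h.cV.mul (by fun_prop : Continuous fun p : ℝ × ℝ => c p.2).continuousOn)
    (h.cVr.mul (by fun_prop : Continuous fun p : ℝ × ℝ => c p.2).continuousOn)
    (fun r hr θ => (h.hr r hr θ).mul_const _) hr

lemma hasDerivAt_mode_deriv (h : PolarSolution S V Vr Vrr Vt Vtt G) (hc : Continuous c)
    {r : ℝ} (hr : r ∈ Ioo (-S) S) :
    HasDerivAt (fun r => cavg (fun θ => Vr r θ * c θ)) (cavg (fun θ => Vrr r θ * c θ)) r :=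
  hasDerivAt_cavg (H := fun r θ => Vr r θ * c θ) (H' := fun r θ => Vrr r θ * c θ)
    (h.cVr.mul (by fun_prop : Continuous fun p : ℝ × ℝ => c p.2).continuousOn)
    (h.cVrr.mul (by fun_prop : Continuous fun p : ℝ × ℝ => c p.2).continuousOn)
    (fun r hr θ => (h.hrr r hr θ).mul_const _) hr

/-- The equation of a Fourier mode of order one. -/
lemma mode_eq (h : PolarSolution S V Vr Vrr Vt Vtt G) (hc : ∀ θ, HasDerivAt c (c' θ) θ)
    (hc' : ∀ θ, HasDerivAt c' (-c θ) θ) (hp : c (2 * π) = c 0) (hp' : c' (2 * π) = c' 0)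
    {r : ℝ} (hr : r ∈ Ioo (-S) S) :
    r ^ 2 * cavg (fun θ => Vrr r θ * c θ) + r * cavg (fun θ => Vr r θ * c θ)
      = cavg (fun θ => V r θ * c θ) - r ^ 2 * cavg (fun θ => G r θ * c θ) := by
  have cc : Continuous c := continuous_iff_continuousAt.2 fun θ => (hc θ).continuousAt
  have cc' : Continuous c' := continuous_iff_continuousAt.2 fun θ => (hc' θ).continuousAt
  have c1 := continuous_slice h.cVrr hr
  have c2 := continuous_slice h.cVr hr
  have c3 := continuous_slice h.cVtt hr
  have c4 := continuous_slice h.cG hr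
  have c5 := continuous_slice h.cVt hr
  have e1 := cavg_deriv_mul (h.htt r hr) c3 hc cc' (h.pert r hr) hp
  have e2 := cavg_deriv_mul (h.ht r hr) c5 hc' cc.neg (h.per r hr) hp'
  have e3 : cavg (fun θ => V r θ * -c θ) = -cavg (fun θ => V r θ * c θ) := by
    rw [← cavg_neg]; congr 1; funext θ; ring
  rw [e2, e3] at e1
  have e4 : cavg (fun θ => r ^ 2 * (Vrr r θ * c θ) + r * (Vr r θ * c θ) + Vtt r θ * c θ)
      = cavg (fun θ => -(r ^ 2) * (G r θ * c θ)) := by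
    congr 1; funext θ
    linear_combination c θ * h.pde r hr θ
  rw [cavg_add (by fun_prop) (by fun_prop), cavg_add (by fun_prop) (by fun_prop), cavg_const_mul,
    cavg_const_mul, cavg_const_mul, e1] at e4
  linarith

end modes

lemma hasDerivAt_mean (h : PolarSolution S V Vr Vrr Vt Vtt G) {r : ℝ} (hr : r ∈ Ioo (-S) S) :
    HasDerivAt (fun r => cavg (V r)) (cavg (Vr r)) r :=
  hasDerivAt_cavg h.cV h.cVr h.hr hr

lemma hasDerivAt_mean_deriv (h : PolarSolution S V Vr Vrr Vt Vtt G) {r : ℝ}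
    (hr : r ∈ Ioo (-S) S) : HasDerivAt (fun r => cavg (Vr r)) (cavg (Vrr r)) r :=
  hasDerivAt_cavg h.cVr h.cVrr h.hrr hr

lemma mean_eq (h : PolarSolution S V Vr Vrr Vt Vtt G) {r : ℝ} (hr : r ∈ Ioo (-S) S) :
    r ^ 2 * cavg (Vrr r) + r * cavg (Vr r) = -(r ^ 2 * cavg (G r)) := by
  have c1 := continuous_slice h.cVrr hr
  have c2 := continuous_slice h.cVr hr
  have c3 := continuous_slice h.cVtt hr
  have c4 := continuous_slice h.cG hr
  have e1 := cavg_deriv_mul (h.htt r hr) c3 (v := fun _ => 1) (v' := fun _ => 0)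
    (fun θ => hasDerivAt_const _ _) continuous_const (h.pert r hr) rfl
  have e0 : cavg (fun θ => Vt r θ * 0) = 0 := by simpa using cavg_const 0
  simp only [mul_one] at e1
  rw [e0] at e1
  have e4 : cavg (fun θ => r ^ 2 * Vrr r θ + r * Vr r θ + Vtt r θ)
      = cavg (fun θ => -(r ^ 2) * G r θ) := by
    congr 1; funext θ
    linear_combination h.pde r hr θ
  rw [cavg_add (by fun_prop) (by fun_prop), cavg_add (by fun_prop) (by fun_prop), cavg_const_mul,
    cavg_const_mul, cavg_const_mul, e1] at e4
  linarith

/-- The normalized flux through the circle of radius `r`. -/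
lemma hasDerivAt_flux (h : PolarSolution S V Vr Vrr Vt Vtt G) {r : ℝ} (hr : r ∈ Ioo (-S) S) :
    HasDerivAt (fun r => -(r * cavg (Vr r))) (r * cavg (G r)) r := by
  have h1 := ((hasDerivAt_id r).mul (h.hasDerivAt_mean_deriv hr)).neg
  refine h1.congr_deriv ?_
  simp only [id, one_mul]
  rcases eq_or_ne r 0 with rfl | h0
  · have : cavg (Vr 0) = 0 := by
      rw [show Vr 0 = fun _ => 0 from funext h.centerr, cavg_const]
    simp [this]
  · have := h.mean_eq hr
    apply mul_left_cancel₀ h0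
    linarith

lemma hasDerivAt_sq (h : PolarSolution S V Vr Vrr Vt Vtt G) {r : ℝ} (hr : r ∈ Ioo (-S) S) :
    HasDerivAt (fun r => cavg (fun θ => V r θ ^ 2)) (2 * cavg (fun θ => V r θ * Vr r θ)) r := by
  rw [← cavg_const_mul]
  refine hasDerivAt_cavg (H := fun r θ => V r θ ^ 2) (H' := fun r θ => 2 * (V r θ * Vr r θ))
    ?_ ?_ (fun r hr θ => ?_) hr
  · exact (h.cV.pow 2 :)
  · exact ((continuousOn_const (c := (2 : ℝ))).mul (h.cV.mul h.cVr) :)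
  · exact ((h.hr r hr θ).pow 2).congr_deriv (by push_cast; ring)

lemma hasDerivAt_sq_deriv (h : PolarSolution S V Vr Vrr Vt Vtt G) {r : ℝ}
    (hr : r ∈ Ioo (-S) S) :
    HasDerivAt (fun r => 2 * cavg (fun θ => V r θ * Vr r θ))
      (2 * cavg (fun θ => Vr r θ ^ 2 + V r θ * Vrr r θ)) r := by
  apply HasDerivAt.const_mul
  refine hasDerivAt_cavg (H := fun r θ => V r θ * Vr r θ)
    (H' := fun r θ => Vr r θ ^ 2 + V r θ * Vrr r θ)
    (h.cV.mul h.cVr) ?_ (fun r hr θ => ?_) hr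
  · exact ((h.cVr.pow 2).add (h.cV.mul h.cVrr) :)
  · exact ((h.hr r hr θ).mul (h.hrr r hr θ)).congr_deriv (by ring)

lemma sq_eq (h : PolarSolution S V Vr Vrr Vt Vtt G) {r : ℝ} (hr : r ∈ Ioo (-S) S) :
    r ^ 2 * (2 * cavg (fun θ => Vr r θ ^ 2 + V r θ * Vrr r θ))
        + r * (2 * cavg (fun θ => V r θ * Vr r θ))
      = 2 * r ^ 2 * cavg (fun θ => Vr r θ ^ 2) + 2 * cavg (fun θ => Vt r θ ^ 2)
        - 2 * r ^ 2 * cavg (fun θ => V r θ * G r θ) := by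
  have c0 := continuous_slice h.cV hr
  have c1 := continuous_slice h.cVrr hr
  have c2 := continuous_slice h.cVr hr
  have c3 := continuous_slice h.cVtt hr
  have c4 := continuous_slice h.cG hr
  have c5 := continuous_slice h.cVt hr
  have e1 := cavg_deriv_mul (h.htt r hr) c3 (h.ht r hr) c5 (h.pert r hr) (h.per r hr)
  have e2 : cavg (fun θ => Vt r θ * Vt r θ) = cavg (fun θ => Vt r θ ^ 2) := by
    congr 1; funext θ; ring
  rw [e2] at e1
  have e4 : cavg (fun θ => r ^ 2 * (V r θ * Vrr r θ) + r * (V r θ * Vr r θ) + Vtt r θ * V r θ)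
      = cavg (fun θ => -(r ^ 2) * (V r θ * G r θ)) := by
    congr 1; funext θ
    linear_combination V r θ * h.pde r hr θ
  rw [cavg_add (by fun_prop) (by fun_prop), cavg_add (by fun_prop) (by fun_prop), cavg_const_mul,
    cavg_const_mul, cavg_const_mul, e1] at e4
  rw [cavg_add (by fun_prop) (by fun_prop)]
  linarith

end PolarSolution

/-- The mean square over the circle of the modes of order at least two. -/
def psi (V : ℝ → ℝ → ℝ) (r : ℝ) : ℝ :=
  cavg (fun θ => V r θ ^ 2) - cavg (V r) ^ 2 - 2 * cavg (fun θ => V r θ * cos θ) ^ 2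
    - 2 * cavg (fun θ => V r θ * sin θ) ^ 2

namespace PolarSolution

variable {S : ℝ} {V Vr Vrr Vt Vtt G : ℝ → ℝ → ℝ}

lemma psi_ineq (h : PolarSolution S V Vr Vrr Vt Vtt G) :
    ∃ d dd : ℝ → ℝ, (∀ r ∈ Ioo (-S) S, HasDerivAt (psi V) (d r) r) ∧
      (∀ r ∈ Ioo (-S) S, HasDerivAt d (dd r) r) ∧
      ∀ r ∈ Ioo (-S) S, 8 * psi V r - 2 * r ^ 2 * (cavg (fun θ => V r θ * G r θ)
          - cavg (V r) * cavg (G r)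
          - 2 * cavg (fun θ => V r θ * cos θ) * cavg (fun θ => G r θ * cos θ)
          - 2 * cavg (fun θ => V r θ * sin θ) * cavg (fun θ => G r θ * sin θ))
        ≤ r ^ 2 * dd r + r * d r := by
  refine ⟨fun r => 2 * cavg (fun θ => V r θ * Vr r θ) - 2 * (cavg (V r) * cavg (Vr r))
      - 4 * (cavg (fun θ => V r θ * cos θ) * cavg (fun θ => Vr r θ * cos θ))
      - 4 * (cavg (fun θ => V r θ * sin θ) * cavg (fun θ => Vr r θ * sin θ)),
    fun r => 2 * cavg (fun θ => Vr r θ ^ 2 + V r θ * Vrr r θ)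
      - 2 * (cavg (Vr r) * cavg (Vr r) + cavg (V r) * cavg (Vrr r))
      - 4 * (cavg (fun θ => Vr r θ * cos θ) * cavg (fun θ => Vr r θ * cos θ)
        + cavg (fun θ => V r θ * cos θ) * cavg (fun θ => Vrr r θ * cos θ))
      - 4 * (cavg (fun θ => Vr r θ * sin θ) * cavg (fun θ => Vr r θ * sin θ)
        + cavg (fun θ => V r θ * sin θ) * cavg (fun θ => Vrr r θ * sin θ)), ?_, ?_, ?_⟩
  · intro r hr
    have h1 := h.hasDerivAt_sq hr
    have h2 := h.hasDerivAt_mean hr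
    have h3 := h.hasDerivAt_mode continuous_cos hr
    have h4 := h.hasDerivAt_mode continuous_sin hr
    refine (((h1.sub (h2.pow 2)).sub ((h3.pow 2).const_mul 2)).sub
      ((h4.pow 2).const_mul 2)).congr_deriv ?_
    push_cast; ring
  · intro r hr
    have h1 := h.hasDerivAt_sq_deriv hr
    have h2 := h.hasDerivAt_mean hr
    have h3 := h.hasDerivAt_mode continuous_cos hr
    have h4 := h.hasDerivAt_mode continuous_sin hr
    have h2' := h.hasDerivAt_mean_deriv hr
    have h3' := h.hasDerivAt_mode_deriv continuous_cos hr
    have h4' := h.hasDerivAt_mode_deriv continuous_sin hr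
    exact ((h1.sub ((h2.mul h2').const_mul 2)).sub ((h3.mul h3').const_mul 4)).sub
      ((h4.mul h4').const_mul 4)
  · intro r hr
    have e1 := h.sq_eq hr
    have e2 := h.mean_eq hr
    have e3 := h.mode_eq hasDerivAt_cos (fun θ => (hasDerivAt_sin θ).neg) (by simp) (by simp) hr
    have e4 := h.mode_eq hasDerivAt_sin hasDerivAt_cos (by simp) (by simp) hr
    have b := cavg_bessel (continuous_slice h.cVr hr)
    have w := wirtinger_two (h.ht r hr) (continuous_slice h.cVt hr) (h.per r hr)
    have b' := mul_nonneg (sq_nonneg r) (sub_nonneg.2 b)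
    unfold psi
    set M := cavg (fun θ => V r θ ^ 2)
    set β := cavg (V r)
    set β' := cavg (Vr r)
    set β2 := cavg (Vrr r)
    set p := cavg (fun θ => V r θ * cos θ)
    set q := cavg (fun θ => V r θ * sin θ)
    set p' := cavg (fun θ => Vr r θ * cos θ)
    set q' := cavg (fun θ => Vr r θ * sin θ)
    set p2 := cavg (fun θ => Vrr r θ * cos θ)
    set q2 := cavg (fun θ => Vrr r θ * sin θ)
    have k : r ^ 2 * (2 * cavg (fun θ => Vr r θ ^ 2 + V r θ * Vrr r θ)
        - 2 * (β' * β' + β * β2) - 4 * (p' * p' + p * p2) - 4 * (q' * q' + q * q2))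
        + r * (2 * cavg (fun θ => V r θ * Vr r θ) - 2 * (β * β') - 4 * (p * p') - 4 * (q * q'))
      = 2 * r ^ 2 * cavg (fun θ => Vr r θ ^ 2) + 2 * cavg (fun θ => Vt r θ ^ 2)
        - 2 * r ^ 2 * cavg (fun θ => V r θ * G r θ) - 2 * r ^ 2 * β' ^ 2 - 4 * r ^ 2 * p' ^ 2
        - 4 * r ^ 2 * q' ^ 2 + 2 * β * (r ^ 2 * cavg (G r))
        - 4 * p * (p - r ^ 2 * cavg (fun θ => G r θ * cos θ))
        - 4 * q * (q - r ^ 2 * cavg (fun θ => G r θ * sin θ)) := by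
      linear_combination e1 - 2 * β * e2 - 4 * p * e3 - 4 * q * e4
    rw [k]
    linarith

end PolarSolution

/-- Second order Taylor lower bound from a lower bound of the second derivative. -/
lemma taylor_two_le {g g1 g2 : ℝ → ℝ} (h1 : ∀ x, HasDerivAt g (g1 x) x)
    (h2 : ∀ x, HasDerivAt g1 (g2 x) x) {s : Set ℝ} (hs : s.OrdConnected) {c : ℝ}
    (hc : ∀ x ∈ s, c ≤ g2 x) {x y : ℝ} (hx : x ∈ s) (hy : y ∈ s) :
    g x + g1 x * (y - x) + c / 2 * (y - x) ^ 2 ≤ g y := by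
  set φ : ℝ → ℝ := fun t => g t - g1 x * (t - x) - c / 2 * (t - x) ^ 2
  have d1 : ∀ t, HasDerivAt φ (g1 t - g1 x - c * (t - x)) t := fun t => by
    refine (((h1 t).sub (((hasDerivAt_id t).sub_const x).const_mul (g1 x))).sub
      ((((hasDerivAt_id t).sub_const x).pow 2).const_mul (c / 2))).congr_deriv ?_
    simp; ring
  have d2 : ∀ t, HasDerivAt (fun t => g1 t - g1 x - c * (t - x)) (g2 t - c) t := fun t => by
    refine (((h2 t).sub_const (g1 x)).sub
      (((hasDerivAt_id t).sub_const x).const_mul c)).congr_deriv ?_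
    simp
  have key : φ x ≤ φ y := by
    rcases lt_trichotomy x y with h | h | h
    · obtain ⟨ξ, hξ, e1⟩ := exists_hasDerivAt_eq_slope φ _ h
        (fun t _ => (d1 t).continuousAt.continuousWithinAt) (fun t _ => d1 t)
      obtain ⟨ζ, hζ, e2⟩ := exists_hasDerivAt_eq_slope _ _ hξ.1
        (fun t _ => (d2 t).continuousAt.continuousWithinAt) (fun t _ => d2 t)
      have := hc ζ (hs.out hx hy ⟨hζ.1.le, (hζ.2.trans hξ.2).le⟩)
      have a : 0 < ξ - x := sub_pos.2 hξ.1
      have b : 0 < y - x := sub_pos.2 h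
      rw [eq_div_iff b.ne'] at e1
      rw [eq_div_iff a.ne'] at e2
      nlinarith [mul_nonneg (mul_nonneg (sub_nonneg.2 this) a.le) b.le]
    · rw [h]
    · obtain ⟨ξ, hξ, e1⟩ := exists_hasDerivAt_eq_slope φ _ h
        (fun t _ => (d1 t).continuousAt.continuousWithinAt) (fun t _ => d1 t)
      obtain ⟨ζ, hζ, e2⟩ := exists_hasDerivAt_eq_slope _ _ hξ.2
        (fun t _ => (d2 t).continuousAt.continuousWithinAt) (fun t _ => d2 t)
      have := hc ζ (hs.out hy hx ⟨(hξ.1.trans hζ.1).le, hζ.2.le⟩)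
      have a : 0 < x - ξ := sub_pos.2 hξ.2
      have b : 0 < x - y := sub_pos.2 h
      rw [eq_div_iff b.ne'] at e1
      rw [eq_div_iff a.ne'] at e2
      nlinarith [mul_nonneg (mul_nonneg (sub_nonneg.2 this) a.le) b.le]
  simp only [φ] at key
  linarith

lemma taylor_two_ge {g g1 g2 : ℝ → ℝ} (h1 : ∀ x, HasDerivAt g (g1 x) x)
    (h2 : ∀ x, HasDerivAt g1 (g2 x) x) {s : Set ℝ} (hs : s.OrdConnected) {c : ℝ}
    (hc : ∀ x ∈ s, g2 x ≤ c) {x y : ℝ} (hx : x ∈ s) (hy : y ∈ s) :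
    g y ≤ g x + g1 x * (y - x) + c / 2 * (y - x) ^ 2 := by
  have := taylor_two_le (g := fun x => -g x) (g1 := fun x => -g1 x) (g2 := fun x => -g2 x)
    (fun x => (h1 x).neg) (fun x => (h2 x).neg) hs (c := -c)
    (fun x hx => neg_le_neg (hc x hx)) hx hy
  linarith

/-- The rescaled nonlinearity. -/
def nl (k x : ℝ) : ℝ := (1 + k * x) * exp (2 * x + k * x ^ 2)

def nl' (k x : ℝ) : ℝ := (k + 2 * (1 + k * x) ^ 2) * exp (2 * x + k * x ^ 2)

def nl'' (k x : ℝ) : ℝ :=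
  (6 * k * (1 + k * x) + 4 * (1 + k * x) ^ 3) * exp (2 * x + k * x ^ 2)

lemma continuous_nl (k : ℝ) : Continuous (nl k) := by unfold nl; fun_prop

lemma hasDerivAt_nl (k x : ℝ) : HasDerivAt (nl k) (nl' k x) x := by
  have e : HasDerivAt (fun x => 2 * x + k * x ^ 2) (2 + k * (2 * x)) x := by
    exact (((hasDerivAt_id x).const_mul 2).add ((hasDerivAt_pow 2 x).const_mul k)).congr_deriv
      (by simp)
  have e' : HasDerivAt (fun x => 1 + k * x) k x := by
    simpa using ((hasDerivAt_id x).const_mul k).const_add 1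
  refine (e'.mul e.exp).congr_deriv ?_
  unfold nl'; ring

lemma hasDerivAt_nl' (k x : ℝ) : HasDerivAt (nl' k) (nl'' k x) x := by
  have e : HasDerivAt (fun x => 2 * x + k * x ^ 2) (2 + k * (2 * x)) x := by
    exact (((hasDerivAt_id x).const_mul 2).add ((hasDerivAt_pow 2 x).const_mul k)).congr_deriv
      (by simp)
  have e' : HasDerivAt (fun x => 1 + k * x) k x := by
    simpa using ((hasDerivAt_id x).const_mul k).const_add 1
  refine ((((e'.pow 2).const_mul 2).const_add k).mul e.exp).congr_deriv ?_
  unfold nl''; simp; ring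

/-- A jointly continuous function of `(k, x)` is close to its value at `(0, U)`. -/
lemma unif_near {H : ℝ → ℝ → ℝ} (hH : Continuous (Function.uncurry H)) {δ : ℝ} (hδ : 0 < δ) :
    ∃ η > 0, ∀ k ∈ Icc (0 : ℝ) η, ∀ U ∈ Icc (-3 : ℝ) 0, ∀ x, |x - U| ≤ η →
      |H k x - H 0 U| ≤ δ := by
  have hc : IsCompact (Icc (0 : ℝ) 1 ×ˢ Icc (-4 : ℝ) 1) := isCompact_Icc.prod isCompact_Icc
  obtain ⟨η, hη, h⟩ := Metric.uniformContinuousOn_iff.1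
    (hc.uniformContinuousOn_of_continuous hH.continuousOn) δ hδ
  refine ⟨min (η / 2) (1 / 2), by positivity, fun k hk U hU x hx => ?_⟩
  have a1 := hk.2.trans (min_le_left _ _)
  have a2 := hk.2.trans (min_le_right _ _)
  have b1 := hx.trans (min_le_left _ _)
  have b2 := abs_le.1 (hx.trans (min_le_right _ _))
  have := h (k, x) ⟨⟨hk.1, by linarith⟩, ⟨by linarith [hU.1], by linarith [hU.2]⟩⟩ (0, U)
    ⟨by norm_num, ⟨by linarith [hU.1], by linarith [hU.2]⟩⟩ (by
      rw [Prod.dist_eq, max_lt_iff, Real.dist_eq, Real.dist_eq]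
      constructor
      · simp only [sub_zero]; rw [abs_of_nonneg hk.1]; linarith
      · simp only []; linarith)
  rw [Real.dist_eq] at this
  exact this.le

lemma nl_expansion {δ : ℝ} (hδ : 0 < δ) :
    ∃ η > 0, η ≤ 1 / 10 ∧ ∀ k ∈ Icc (0 : ℝ) η, ∀ U ∈ Icc (-3 : ℝ) 0, ∀ x, |x - U| ≤ η →
      |nl k x - exp (2 * U)| ≤ δ ∧ |nl' k x - 2 * exp (2 * U)| ≤ δ ∧
      |nl'' k x - 4 * exp (2 * U)| ≤ δ ∧
      |nl k x - exp (2 * x) - k * (exp (2 * U) * (U ^ 2 + U))| ≤ δ * k := by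
  obtain ⟨η0, h0, H0⟩ := unif_near (H := nl) (by unfold nl Function.uncurry; fun_prop) hδ
  obtain ⟨η1, h1, H1⟩ := unif_near (H := nl') (by unfold nl' Function.uncurry; fun_prop) hδ
  obtain ⟨η2, h2, H2⟩ := unif_near (H := nl'') (by unfold nl'' Function.uncurry; fun_prop) hδ
  obtain ⟨η3, h3, H3⟩ := unif_near
    (H := fun k x => (x + (1 + k * x) * x ^ 2) * exp (2 * x + k * x ^ 2))
    (by unfold Function.uncurry; fun_prop) hδ
  refine ⟨min (min (min η0 η1) (min η2 η3)) (1 / 10), by positivity, min_le_right _ _, ?_⟩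
  intro k hk U hU x hx
  have m0 : min (min (min η0 η1) (min η2 η3)) (1 / 10) ≤ η0 := by simp
  have m1 : min (min (min η0 η1) (min η2 η3)) (1 / 10) ≤ η1 := by simp
  have m2 : min (min (min η0 η1) (min η2 η3)) (1 / 10) ≤ η2 := by simp
  have m3 : min (min (min η0 η1) (min η2 η3)) (1 / 10) ≤ η3 := by simp
  refine ⟨?_, ?_, ?_, ?_⟩
  · simpa [nl] using H0 k ⟨hk.1, hk.2.trans m0⟩ U hU x (hx.trans m0)
  · simpa [nl'] using H1 k ⟨hk.1, hk.2.trans m1⟩ U hU x (hx.trans m1)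
  · simpa [nl''] using H2 k ⟨hk.1, hk.2.trans m2⟩ U hU x (hx.trans m2)
  · have hd : ∀ t, HasDerivAt (fun t => nl t x - t * (exp (2 * U) * (U ^ 2 + U)))
        ((x + (1 + t * x) * x ^ 2) * exp (2 * x + t * x ^ 2) - exp (2 * U) * (U ^ 2 + U)) t := by
      intro t
      have e : HasDerivAt (fun t => 2 * x + t * x ^ 2) (x ^ 2) t := by
        simpa using ((hasDerivAt_id t).mul_const (x ^ 2)).const_add (2 * x)
      have e' : HasDerivAt (fun t => 1 + t * x) x t := by
        simpa using ((hasDerivAt_id t).mul_const x).const_add 1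
      refine ((e'.mul e.exp).sub ((hasDerivAt_id t).mul_const _)).congr_deriv ?_
      simp; ring
    have := (convex_Icc 0 k).norm_image_sub_le_of_norm_hasDerivWithin_le
      (fun t _ => (hd t).hasDerivWithinAt) (C := δ) (fun t ht => by
        have := H3 t ⟨ht.1, ht.2.trans (hk.2.trans m3)⟩ U hU x (hx.trans m3)
        rw [Real.norm_eq_abs]
        convert this using 2
        simp; ring) (left_mem_Icc.2 hk.1) (right_mem_Icc.2 hk.1)
    simp only [Real.norm_eq_abs, sub_zero, abs_of_nonneg hk.1] at this
    convert this using 2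
    simp [nl]; ring

lemma cavg_eq_of_eq {f g : ℝ → ℝ} (h : ∀ θ, f θ = g θ) : cavg f = cavg g := by
  rw [funext h]

lemma cavg_variance {w : ℝ → ℝ} (hw : Continuous w) :
    cavg (fun θ => (w θ - cavg w) ^ 2) = cavg (fun θ => w θ ^ 2) - cavg w ^ 2 := by
  have := cavg_remainder_sq hw (cavg w) 0 0
  simp only [mul_zero, zero_mul, sub_zero] at this
  rw [this]; ring

lemma abs_cavg_mul_le {w c : ℝ → ℝ} (hw : Continuous w) (hc : Continuous c) {η : ℝ}
    (h : ∀ θ, |w θ| ≤ η) (h1 : ∀ θ, |c θ| ≤ 1) : |cavg (fun θ => w θ * c θ)| ≤ η := by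
  have : |cavg (fun θ => w θ * c θ)| ≤ cavg (fun _ => η) :=
    abs_cavg_le (by fun_prop) continuous_const fun θ => by
      rw [abs_mul]
      nlinarith [abs_nonneg (w θ), abs_nonneg (c θ), h θ, h1 θ]
  rwa [cavg_const] at this

section slice

variable {k U ν δ η : ℝ} {w F : ℝ → ℝ}

/-- The first order Taylor remainder of the nonlinearity. -/
private lemma abs_taylor_nl
    (H : ∀ x, |x - U| ≤ η → |nl'' k x - 4 * exp (2 * U)| ≤ δ) {b y : ℝ} (hb : |b - U| ≤ η)
    (hy : |y - U| ≤ η) :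
    |nl k y - nl k b - nl' k b * (y - b) - 2 * exp (2 * U) * (y - b) ^ 2| ≤ δ / 2 * (y - b) ^ 2 := by
  have hs : (Icc (U - η) (U + η)).OrdConnected := ordConnected_Icc
  have mem : ∀ x, |x - U| ≤ η ↔ x ∈ Icc (U - η) (U + η) := fun x => by
    rw [abs_le, mem_Icc]; constructor <;> rintro ⟨h1, h2⟩ <;> constructor <;> linarith
  have l := taylor_two_le (hasDerivAt_nl k) (hasDerivAt_nl' k) hs (c := 4 * exp (2 * U) - δ)
    (fun x hx => by have := (abs_le.1 (H x ((mem x).2 hx))).1; linarith)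
    ((mem b).1 hb) ((mem y).1 hy)
  have r := taylor_two_ge (hasDerivAt_nl k) (hasDerivAt_nl' k) hs (c := 4 * exp (2 * U) + δ)
    (fun x hx => by have := (abs_le.1 (H x ((mem x).2 hx))).2; linarith)
    ((mem b).1 hb) ((mem y).1 hy)
  rw [abs_le]; constructor <;> nlinarith

end slice

set_option maxHeartbeats 1000000 in
/-- Estimates on a circle for the right-hand side of the rescaled equation. -/
lemma slice_estimates {δ : ℝ} (hδ : 0 < δ) (hδ1 : δ ≤ 1) :
    ∃ η > 0, η ≤ δ / 400 ∧ ∀ k ∈ Icc (0 : ℝ) η, ∀ U ∈ Icc (-3 : ℝ) 0, ∀ ν, ∀ w F : ℝ → ℝ,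
      Continuous w → Continuous F → (∀ θ, |w θ - U| ≤ η) → (∀ θ, |F θ - 1| ≤ ν) →
      |cavg w - U| ≤ η ∧ |cavg (fun θ => w θ * cos θ)| ≤ η ∧
      |cavg (fun θ => w θ * sin θ)| ≤ η ∧
      |cavg (fun θ => F θ * nl k (w θ)) - exp (2 * U)| ≤ δ + 2 * ν ∧
      |cavg (fun θ => F θ * nl k (w θ)) - exp (2 * cavg w) - k * (exp (2 * U) * (U ^ 2 + U))
        - 2 * exp (2 * U) * (cavg (fun θ => w θ ^ 2) - cavg w ^ 2)|
        ≤ δ * (cavg (fun θ => w θ ^ 2) - cavg w ^ 2) + δ * k + 2 * ν ∧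
      |cavg (fun θ => F θ * nl k (w θ) * cos θ)| ≤ 3 * |cavg (fun θ => w θ * cos θ)|
        + 3 * (cavg (fun θ => w θ ^ 2) - cavg w ^ 2) + 2 * ν ∧
      |cavg (fun θ => F θ * nl k (w θ) * sin θ)| ≤ 3 * |cavg (fun θ => w θ * sin θ)|
        + 3 * (cavg (fun θ => w θ ^ 2) - cavg w ^ 2) + 2 * ν ∧
      cavg (fun θ => w θ * (F θ * nl k (w θ))) - cavg w * cavg (fun θ => F θ * nl k (w θ))
        - 2 * cavg (fun θ => w θ * cos θ) * cavg (fun θ => F θ * nl k (w θ) * cos θ)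
        - 2 * cavg (fun θ => w θ * sin θ) * cavg (fun θ => F θ * nl k (w θ) * sin θ)
        ≤ (2 * exp (2 * U) + δ) * (cavg (fun θ => w θ ^ 2) - cavg w ^ 2
            - 2 * cavg (fun θ => w θ * cos θ) ^ 2 - 2 * cavg (fun θ => w θ * sin θ) ^ 2)
          + δ * (cavg (fun θ => w θ * cos θ) ^ 2 + cavg (fun θ => w θ * sin θ) ^ 2) + 2 * ν := by
  obtain ⟨η0, h0, h01, H⟩ := nl_expansion (δ := δ / 4) (by positivity)
  refine ⟨min η0 (δ / 400), by positivity, min_le_right _ _, ?_⟩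
  intro k hk U hU ν w F hw hF hwU hF1
  set η := min η0 (δ / 400)
  have hη0 : 0 < η := by positivity
  have hηa : η ≤ η0 := min_le_left _ _
  have hηb : η ≤ δ / 400 := min_le_right _ _
  have Hk := fun x (hx : |x - U| ≤ η) => H k ⟨hk.1, hk.2.trans hηa⟩ U hU x (hx.trans hηa)
  have hU1 : exp (2 * U) ≤ 1 := exp_le_one_iff.2 (by linarith [hU.2])
  have hU0 := exp_pos (2 * U)
  have hν : 0 ≤ ν := (abs_nonneg _).trans (hF1 0)
  set b := cavg w with hb_def
  have hb : |b - U| ≤ η := by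
    have e : b - U = cavg (fun θ => w θ - U) := by
      rw [cavg_sub hw continuous_const, cavg_const]
    rw [e]
    have := abs_cavg_le (f := fun θ => w θ - U) (g := fun _ => η) (by fun_prop) continuous_const hwU
    rwa [cavg_const] at this
  have mode : ∀ c : ℝ → ℝ, Continuous c → (∀ θ, |c θ| ≤ 1) → cavg c = 0 →
      |cavg (fun θ => w θ * c θ)| ≤ η := by
    intro c cc hc1 hc0
    have e : cavg (fun θ => w θ * c θ) = cavg (fun θ => (w θ - U) * c θ) := by
      rw [cavg_eq_of_eq (f := fun θ => (w θ - U) * c θ) (g := fun θ => w θ * c θ - U * c θ)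
        (fun θ => by ring), cavg_sub (by fun_prop) (by fun_prop), cavg_const_mul,
        show cavg (fun θ => c θ) = 0 from hc0]
      ring
    rw [e]
    exact abs_cavg_mul_le (by fun_prop) cc hwU hc1
  have hp := mode cos continuous_cos abs_cos_le_one cavg_cos
  have hq := mode sin continuous_sin abs_sin_le_one cavg_sin
  have hvar := cavg_variance hw
  rw [← hb_def] at hvar
  set Φ := cavg (fun θ => w θ ^ 2) - b ^ 2 with hΦ
  have hΦ0 : 0 ≤ Φ := by rw [← hvar]; exact cavg_nonneg fun θ => sq_nonneg _
  have cg : Continuous fun θ => nl k (w θ) := (continuous_nl k).comp hw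
  set R : ℝ → ℝ := fun θ => nl k (w θ) - nl k b - nl' k b * (w θ - b) with hR
  have cR : Continuous R := by fun_prop
  have hRt : ∀ θ, |R θ - 2 * exp (2 * U) * (w θ - b) ^ 2| ≤ δ / 8 * (w θ - b) ^ 2 := fun θ => by
    have := abs_taylor_nl (fun x hx => (Hk x hx).2.2.1) hb (hwU θ)
    convert this using 2; ring
  have hR3 : ∀ θ, |R θ| ≤ 3 * (w θ - b) ^ 2 := fun θ => by
    have := abs_le.1 (hRt θ)
    have s := sq_nonneg (w θ - b)
    rw [abs_le]; constructor <;> nlinarith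
  set E : ℝ → ℝ := fun θ => (F θ - 1) * nl k (w θ) with hE
  have cE : Continuous E := by fun_prop
  have hE2 : ∀ θ, |E θ| ≤ 3 / 2 * ν := fun θ => by
    simp only [hE]
    rw [abs_mul]
    have a := abs_le.1 (Hk _ (hwU θ)).1
    have : |nl k (w θ)| ≤ 3 / 2 := by rw [abs_le]; constructor <;> linarith
    nlinarith [hF1 θ, abs_nonneg (F θ - 1), abs_nonneg (nl k (w θ))]
  have hGe : ∀ θ, F θ * nl k (w θ) = nl k b + nl' k b * (w θ - b) + R θ + E θ := fun θ => by
    simp only [hR, hE]; ring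
  have hcb := Hk b hb
  have hg' := abs_le.1 hcb.2.1
  -- pairing with a zero mean weight
  have pair : ∀ c : ℝ → ℝ, Continuous c → cavg c = 0 →
      cavg (fun θ => F θ * nl k (w θ) * c θ) = nl' k b * cavg (fun θ => w θ * c θ)
        + cavg (fun θ => R θ * c θ) + cavg (fun θ => E θ * c θ) := by
    intro c cc hc0
    rw [cavg_eq_of_eq (g := fun θ => (nl k b - nl' k b * b) * c θ + nl' k b * (w θ * c θ)
      + R θ * c θ + E θ * c θ) (fun θ => by rw [hGe]; ring),
      cavg_add (by fun_prop) (by fun_prop), cavg_add (by fun_prop) (by fun_prop),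
      cavg_add (by fun_prop) (by fun_prop), cavg_const_mul, cavg_const_mul,
      show cavg (fun θ => c θ) = 0 from hc0]
    ring
  have pairR : ∀ c : ℝ → ℝ, Continuous c → ∀ t : ℝ, (∀ θ, |c θ| ≤ t) →
      |cavg (fun θ => R θ * c θ)| ≤ 3 * t * Φ := by
    intro c cc t hc1
    have := abs_cavg_le (f := fun θ => R θ * c θ) (g := fun θ => 3 * t * (w θ - b) ^ 2)
      (by fun_prop) (by fun_prop) fun θ => by
        rw [abs_mul]
        calc |R θ| * |c θ| ≤ 3 * (w θ - b) ^ 2 * t :=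
              mul_le_mul (hR3 θ) (hc1 θ) (abs_nonneg _) (by positivity)
          _ = _ := by ring
    rwa [cavg_const_mul, hvar] at this
  have pairE : ∀ c : ℝ → ℝ, Continuous c → ∀ t : ℝ, (∀ θ, |c θ| ≤ t) →
      |cavg (fun θ => E θ * c θ)| ≤ 3 / 2 * ν * t := by
    intro c cc t hc1
    have := abs_cavg_le (f := fun θ => E θ * c θ) (g := fun θ => 3 / 2 * ν * t)
      (by fun_prop) (by fun_prop) fun θ => by
        rw [abs_mul]
        exact mul_le_mul (hE2 θ) (hc1 θ) (abs_nonneg _) (by positivity)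
    rwa [cavg_const] at this
  have modeG : ∀ c : ℝ → ℝ, Continuous c → (∀ θ, |c θ| ≤ 1) → cavg c = 0 →
      |cavg (fun θ => F θ * nl k (w θ) * c θ)| ≤ 3 * |cavg (fun θ => w θ * c θ)|
        + 3 * Φ + 2 * ν := by
    intro c cc hc1 hc0
    rw [pair c cc hc0]
    have a1 := pairR c cc 1 hc1
    have a2 := pairE c cc 1 hc1
    have a3 : |nl' k b * cavg (fun θ => w θ * c θ)| ≤ 3 * |cavg (fun θ => w θ * c θ)| := by
      rw [abs_mul]
      refine mul_le_mul_of_nonneg_right ?_ (abs_nonneg _)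
      rw [abs_le]; constructor <;> linarith
    have := abs_add_three (nl' k b * cavg (fun θ => w θ * c θ)) (cavg (fun θ => R θ * c θ))
      (cavg (fun θ => E θ * c θ))
    linarith
  refine ⟨hb, hp, hq, ?_, ?_, modeG cos continuous_cos abs_cos_le_one cavg_cos,
    modeG sin continuous_sin abs_sin_le_one cavg_sin, ?_⟩
  · have := abs_cavg_le (f := fun θ => F θ * nl k (w θ) - exp (2 * U))
      (g := fun _ => δ + 2 * ν) (by fun_prop) (by fun_prop) fun θ => by
        have a1 := abs_le.1 (Hk _ (hwU θ)).1
        have a2 := abs_le.1 (hE2 θ)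
        simp only [hE] at a2
        rw [abs_le]; constructor <;> linarith
    rwa [cavg_sub (by fun_prop) (by fun_prop), cavg_const, cavg_const] at this
  · have e1 : cavg (fun θ => F θ * nl k (w θ)) = nl k b + cavg R + cavg E := by
      rw [cavg_eq_of_eq (g := fun θ => (nl k b - nl' k b * b) + nl' k b * w θ + R θ + E θ)
        (fun θ => by rw [hGe]; ring),
        cavg_add (by fun_prop) (by fun_prop), cavg_add (by fun_prop) (by fun_prop),
        cavg_add (by fun_prop) (by fun_prop), cavg_const, cavg_const_mul]
      ring
    have e2 := abs_cavg_le (f := fun θ => R θ - 2 * exp (2 * U) * (w θ - b) ^ 2)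
      (by fun_prop) (by fun_prop) hRt
    rw [cavg_sub (by fun_prop) (by fun_prop), cavg_const_mul, cavg_const_mul, hvar] at e2
    have e3 := abs_cavg_le cE continuous_const hE2
    rw [cavg_const] at e3
    have e4 := abs_le.1 hcb.2.2.2
    have e2' := abs_le.1 e2
    have e3' := abs_le.1 e3
    rw [e1]
    change |_ + cavg (fun θ => R θ) + _ - _ - _ - _| ≤ _
    have k0 := mul_nonneg hδ.le hk.1
    have f0 := mul_nonneg hδ.le hΦ0
    rw [abs_le]; constructor <;> linarith
  · set p := cavg (fun θ => w θ * cos θ)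
    set q := cavg (fun θ => w θ * sin θ)
    set ψ : ℝ → ℝ := fun θ => w θ - b - 2 * p * cos θ - 2 * q * sin θ with hψ
    have cψ : Continuous ψ := by fun_prop
    have hψ0 : cavg ψ = 0 := by
      simp only [hψ]
      rw [cavg_sub (by fun_prop) (by fun_prop), cavg_sub (by fun_prop) (by fun_prop),
        cavg_sub (by fun_prop) (by fun_prop), cavg_const_mul, cavg_const_mul, cavg_const,
        show cavg (fun θ => cos θ) = 0 from cavg_cos, show cavg (fun θ => sin θ) = 0 from cavg_sin]
      simp [hb_def]
    have hψ10 : ∀ θ, |ψ θ| ≤ 10 * η := fun θ => by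
      have a1 := abs_le.1 (hwU θ)
      have a2 := abs_le.1 hb
      have a3 : |p * cos θ| ≤ η := by
        rw [abs_mul]; nlinarith [abs_cos_le_one θ, abs_nonneg p, abs_nonneg (cos θ)]
      have a4 : |q * sin θ| ≤ η := by
        rw [abs_mul]; nlinarith [abs_sin_le_one θ, abs_nonneg q, abs_nonneg (sin θ)]
      have a3 := abs_le.1 a3
      have a4 := abs_le.1 a4
      rw [abs_le]; simp only [hψ]; constructor <;> linarith
    have e1 : ∀ v : ℝ → ℝ, Continuous v → cavg (fun θ => v θ * ψ θ)
        = cavg (fun θ => w θ * v θ) - b * cavg v - 2 * p * cavg (fun θ => v θ * cos θ)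
          - 2 * q * cavg (fun θ => v θ * sin θ) := by
      intro v cv
      rw [cavg_eq_of_eq (f := fun θ => v θ * ψ θ) (g := fun θ => w θ * v θ - b * v θ
        - 2 * p * (v θ * cos θ) - 2 * q * (v θ * sin θ))
        (fun θ => by simp only [hψ]; ring),
        cavg_sub (by fun_prop) (by fun_prop), cavg_sub (by fun_prop) (by fun_prop),
        cavg_sub (by fun_prop) (by fun_prop), cavg_const_mul, cavg_const_mul, cavg_const_mul]
    have e2 := e1 w hw
    have e3 := e1 (fun θ => F θ * nl k (w θ)) (by fun_prop)
    rw [← e3, pair ψ cψ hψ0]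
    have a1 := (abs_le.1 (pairR ψ cψ _ hψ10)).2
    have a2 := (abs_le.1 (pairE ψ cψ _ hψ10)).2
    have hww : cavg (fun θ => w θ * w θ) = cavg (fun θ => w θ ^ 2) :=
      cavg_eq_of_eq fun θ => by ring
    have e4 : cavg (fun θ => w θ * ψ θ) = Φ - 2 * p ^ 2 - 2 * q ^ 2 := by
      rw [e2, hww, ← hb_def]; simp only [hΦ]; ring
    rw [e4]
    have hΨ0 : 0 ≤ Φ - 2 * p ^ 2 - 2 * q ^ 2 := by
      have := cavg_bessel hw
      simp only [hΦ]; linarith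
    set Ψ := Φ - 2 * p ^ 2 - 2 * q ^ 2 with hΨ
    have b1 : nl' k b * Ψ ≤ (2 * exp (2 * U) + δ / 4) * Ψ :=
      mul_le_mul_of_nonneg_right (by linarith) hΨ0
    have b2 : 3 * (10 * η) * Φ ≤ δ / 10 * Φ := mul_le_mul_of_nonneg_right (by linarith) hΦ0
    have b3 : 3 / 2 * ν * (10 * η) ≤ 2 * ν := by nlinarith
    have b4 : Φ = Ψ + 2 * p ^ 2 + 2 * q ^ 2 := by rw [hΨ]; ring
    rw [b4] at b2
    have b5 : δ / 10 * (Ψ + 2 * p ^ 2 + 2 * q ^ 2)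
      = δ / 10 * Ψ + δ / 5 * (p ^ 2 + q ^ 2) := by ring
    have b6 := mul_nonneg hδ.le hΨ0
    have b7 := mul_nonneg hδ.le (add_nonneg (sq_nonneg p) (sq_nonneg q))
    linarith

/-- Monotonicity of `X / r` for subsolutions of `r² X'' + r X' = X`, after a quadratic
correction of `Ψ`. -/
lemma div_mono_of_subsolution {S R κ : ℝ} {Ψ d dd : ℝ → ℝ} (hRS : R < S) (hκ : 0 ≤ κ)
    (h1 : ∀ r ∈ Ioo (-S) S, HasDerivAt Ψ (d r) r) (h2 : ∀ r ∈ Ioo (-S) S, HasDerivAt d (dd r) r)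
    (h : ∀ r ∈ Icc 0 R, Ψ r - κ * r ^ 2 ≤ r ^ 2 * dd r + r * d r) {s t : ℝ} (hs : 0 < s)
    (hst : s ≤ t) (ht : t ≤ R) :
    (Ψ s + κ * s ^ 2) * t ≤ (Ψ t + κ * t ^ 2) * s := by
  have hS : 0 < S := by linarith
  have mem : ∀ r ∈ Icc (0 : ℝ) R, r ∈ Ioo (-S) S := fun r hr =>
    ⟨by linarith [hr.1], by linarith [hr.2]⟩
  set Z : ℝ → ℝ := fun r => r * (r * (d r + 2 * κ * r)) - r * (Ψ r + κ * r ^ 2) with hZ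
  have dZ : ∀ r ∈ Icc (0 : ℝ) R,
      HasDerivAt Z (r ^ 2 * dd r + r * d r - Ψ r + 3 * κ * r ^ 2) r := fun r hr => by
    have e1 := h1 r (mem r hr)
    have e2 := h2 r (mem r hr)
    have i := hasDerivAt_id r
    refine ((i.mul (i.mul (e2.add (i.const_mul (2 * κ))))).sub
      (i.mul (e1.add ((i.pow 2).const_mul κ)))).congr_deriv ?_
    simp; ring
  have mZ : MonotoneOn Z (Icc 0 R) := by
    refine monotoneOn_of_hasDerivWithinAt_nonneg (convex_Icc 0 R)
      (fun r hr => (dZ r hr).continuousAt.continuousWithinAt)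
      (fun r hr => (dZ r (interior_subset hr)).hasDerivWithinAt) fun r hr => ?_
    have := h r (interior_subset hr)
    have : 0 ≤ κ * r ^ 2 := by positivity
    linarith
  have nZ : ∀ r ∈ Icc (0 : ℝ) R, 0 ≤ Z r := fun r hr => by
    have := mZ (left_mem_Icc.2 (hr.1.trans hr.2)) hr hr.1
    simpa [hZ] using this
  have mq : MonotoneOn (fun r => (Ψ r + κ * r ^ 2) / r) (Icc s t) := by
    have dq : ∀ r ∈ Icc s t, HasDerivAt (fun r => (Ψ r + κ * r ^ 2) / r)
        (((d r + 2 * κ * r) * r - (Ψ r + κ * r ^ 2)) / r ^ 2) r := fun r hr => by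
      have hr0 : 0 < r := hs.trans_le hr.1
      have e1 := h1 r (mem r ⟨hr0.le, hr.2.trans ht⟩)
      refine ((e1.add (((hasDerivAt_id r).pow 2).const_mul κ)).div (hasDerivAt_id r)
        hr0.ne').congr_deriv ?_
      simp; ring
    refine monotoneOn_of_hasDerivWithinAt_nonneg (convex_Icc s t)
      (fun r hr => (dq r hr).continuousAt.continuousWithinAt)
      (fun r hr => (dq r (interior_subset hr)).hasDerivWithinAt) fun r hr => ?_
    have hr' := interior_subset hr
    have hr0 : 0 < r := hs.trans_le hr'.1
    have := nZ r ⟨hr0.le, hr'.2.trans ht⟩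
    apply div_nonneg _ (sq_nonneg r)
    refine nonneg_of_mul_nonneg_right (a := r) (le_of_le_of_eq this ?_) hr0
    simp only [hZ]; ring
  have := mq (left_mem_Icc.2 hst) (right_mem_Icc.2 hst) hst
  simp only [] at this
  rwa [div_le_div_iff₀ hs (hs.trans_le hst)] at this

/-- Continuous extension of a function given on a closed interval. -/
lemma exists_continuous_extend {R : ℝ} (hR : 0 ≤ R) {K : ℝ → ℝ} (hK : ContinuousOn K (Icc 0 R)) :
    ∃ K' : ℝ → ℝ, Continuous K' ∧ (∀ r ∈ Icc 0 R, K' r = K r) ∧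
      ∀ r, ∃ s ∈ Icc 0 R, K' r = K s := by
  refine ⟨IccExtend hR ((Icc 0 R).domRestrict K), ?_, ?_, ?_⟩
  · exact continuous_IccExtend_iff.2 (continuousOn_iff_continuous_domRestrict.1 hK)
  · intro r hr; rw [IccExtend_of_mem _ _ hr]; rfl
  · intro r
    exact ⟨projIcc 0 R hR r, (projIcc 0 R hR r).2, rfl⟩

private lemma mode_le {S R : ℝ} {a a1 a2 κ K : ℝ → ℝ} (hRS : R < S)
    (h1 : ∀ r ∈ Ioo (-S) S, HasDerivAt a (a1 r) r)
    (h2 : ∀ r ∈ Ioo (-S) S, HasDerivAt a1 (a2 r) r)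
    (h : ∀ r ∈ Icc 0 R, r ^ 2 * a2 r + r * a1 r = a r - r ^ 2 * κ r)
    (ha0 : a 0 = 0) (ha1 : a1 0 = 0) (hK : Continuous K) (hκ : ∀ r ∈ Icc 0 R, -κ r ≤ K r)
    (hK0 : ∀ r, 0 ≤ K r) {r : ℝ} (hr : r ∈ Icc 0 R) :
    a r ≤ r / 2 * ∫ t in (0 : ℝ)..r, K t := by
  have hR : 0 ≤ R := hr.1.trans hr.2
  have hS : 0 < S := by linarith
  have mem : ∀ r ∈ Icc (0 : ℝ) R, r ∈ Ioo (-S) S := fun r hr =>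
    ⟨by linarith [hr.1], by linarith [hr.2]⟩
  set H : ℝ → ℝ := fun r => ∫ t in (0 : ℝ)..r, K t with hH
  set P : ℝ → ℝ := fun r => ∫ t in (0 : ℝ)..r, t ^ 2 * K t with hP
  have dH : ∀ r, HasDerivAt H (K r) r := fun r => hK.integral_hasStrictDerivAt 0 r |>.hasDerivAt
  have dP : ∀ r, HasDerivAt P (r ^ 2 * K r) r := fun r =>
    ((continuous_pow 2).mul hK).integral_hasStrictDerivAt 0 r |>.hasDerivAt
  have H0 : H 0 = 0 := by simp [hH]
  have P0 : P 0 = 0 := by simp [hP]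
  -- the first integral
  have pP : ∀ r ∈ Icc (0 : ℝ) R, r ^ 2 * a1 r - r * a r ≤ P r := by
    have dp : ∀ r ∈ Icc (0 : ℝ) R, HasDerivAt (fun r => P r - (r ^ 2 * a1 r - r * a r))
        (r ^ 2 * (K r + κ r)) r := fun r hr => by
      have i := hasDerivAt_id r
      refine ((dP r).sub (((i.pow 2).mul (h2 r (mem r hr))).sub
        (i.mul (h1 r (mem r hr))))).congr_deriv ?_
      have := h r hr
      simp; linarith
    have m : MonotoneOn (fun r => P r - (r ^ 2 * a1 r - r * a r)) (Icc 0 R) := by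
      refine monotoneOn_of_hasDerivWithinAt_nonneg (convex_Icc 0 R)
        (fun r hr => (dp r hr).continuousAt.continuousWithinAt)
        (fun r hr => (dp r (interior_subset hr)).hasDerivWithinAt) fun r hr => ?_
      have := hκ r (interior_subset hr)
      exact mul_nonneg (sq_nonneg r) (by linarith)
    intro r hr
    have := m (left_mem_Icc.2 hR) hr hr.1
    simp [P0] at this
    linarith
  rcases hr.1.eq_or_lt with h0 | hr0
  · rw [← h0, ha0]; simp
  have mono : ∀ s ∈ Ioc 0 r, a r / r - H r / 2 + P r / (2 * r ^ 2) ≤ a s / s - H s / 2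
      + P s / (2 * s ^ 2) := by
    intro s hs
    have dq : ∀ t ∈ Icc s r, HasDerivAt (fun t => a t / t - H t / 2 + P t / (2 * t ^ 2))
        ((t ^ 2 * a1 t - t * a t - P t) / t ^ 3) t := fun t ht => by
      have ht0 : 0 < t := hs.1.trans_le ht.1
      have i := hasDerivAt_id t
      refine ((((h1 t (mem t ⟨ht0.le, ht.2.trans hr.2⟩)).div i ht0.ne').sub
        ((dH t).div_const 2)).add ((dP t).div ((i.pow 2).const_mul 2) (by simpa using ht0.ne'))).congr_deriv ?_
      simp
      field_simp
      ring
    have m : AntitoneOn (fun t => a t / t - H t / 2 + P t / (2 * t ^ 2)) (Icc s r) := by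
      refine antitoneOn_of_hasDerivWithinAt_nonpos (convex_Icc s r)
        (fun t ht => (dq t ht).continuousAt.continuousWithinAt)
        (fun t ht => (dq t (interior_subset ht)).hasDerivWithinAt) fun t ht => ?_
      have ht' := interior_subset ht
      have ht0 : 0 < t := hs.1.trans_le ht'.1
      have := pP t ⟨ht0.le, ht'.2.trans hr.2⟩
      exact div_nonpos_of_nonpos_of_nonneg (by linarith) (by positivity)
    exact m (left_mem_Icc.2 hs.2) (right_mem_Icc.2 hs.2) hs.2
  have PH : ∀ s, 0 ≤ s → P s ≤ s ^ 2 * H s := fun s hs => by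
    simp only [hP, hH]
    rw [← intervalIntegral.integral_const_mul]
    refine intervalIntegral.integral_mono_on hs
      (((continuous_pow 2).mul hK).intervalIntegrable _ _)
      ((continuous_const.mul hK).intervalIntegrable _ _) fun t ht => ?_
    exact mul_le_mul_of_nonneg_right (pow_le_pow_left₀ ht.1 ht.2 2) (hK0 t)
  have lim : Tendsto (fun s => a s / s) (𝓝[>] 0) (𝓝 0) := by
    have := (h1 0 (mem 0 ⟨le_rfl, hR⟩)).tendsto_slope_zero_right
    simp only [ha1, zero_add, ha0, sub_zero, smul_eq_mul] at this
    refine this.congr fun s => ?_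
    rw [div_eq_inv_mul]
  have key : a r / r - H r / 2 + P r / (2 * r ^ 2) ≤ 0 := by
    refine ge_of_tendsto lim ?_
    filter_upwards [Ioc_mem_nhdsGT hr0] with s hs
    refine (mono s hs).trans ?_
    have hs0 := hs.1
    have : P s / (2 * s ^ 2) ≤ H s / 2 := by
      rw [div_le_iff₀ (by positivity)]
      linarith [PH s hs.1.le]
    linarith
  have Pn : 0 ≤ P r := intervalIntegral.integral_nonneg hr.1 fun t _ =>
    mul_nonneg (sq_nonneg t) (hK0 t)
  have : 0 ≤ P r / (2 * r ^ 2) := by positivity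
  have : a r / r ≤ H r / 2 := by linarith
  rw [div_le_iff₀ hr0] at this
  linarith

/-- Bound of a solution of `r² a'' + r a' - a = -r² κ` vanishing to second order at the origin. -/
lemma abs_mode_le {S R : ℝ} {a a1 a2 κ K : ℝ → ℝ} (hRS : R < S)
    (h1 : ∀ r ∈ Ioo (-S) S, HasDerivAt a (a1 r) r)
    (h2 : ∀ r ∈ Ioo (-S) S, HasDerivAt a1 (a2 r) r)
    (h : ∀ r ∈ Icc 0 R, r ^ 2 * a2 r + r * a1 r = a r - r ^ 2 * κ r)
    (ha0 : a 0 = 0) (ha1 : a1 0 = 0) (hK : Continuous K) (hκ : ∀ r ∈ Icc 0 R, |κ r| ≤ K r)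
    (hK0 : ∀ r, 0 ≤ K r) {r : ℝ} (hr : r ∈ Icc 0 R) :
    |a r| ≤ r / 2 * ∫ t in (0 : ℝ)..r, K t := by
  rw [abs_le']
  constructor
  · exact mode_le hRS h1 h2 h ha0 ha1 hK
      (fun r hr => (neg_le_abs _).trans (hκ r hr)) hK0 hr
  · refine mode_le (a := fun r => -a r) (κ := fun r => -κ r) hRS (fun r hr => (h1 r hr).neg)
      (fun r hr => (h2 r hr).neg) (fun r hr => ?_) (by simp [ha0]) (by simp [ha1]) hK
      (fun r hr => ?_) hK0 hr
    · linarith [h r hr]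
    · rw [neg_neg]; exact (le_abs_self _).trans (hκ r hr)

lemma modes_gronwall {S ν : ℝ} {a a1 a2 κa b b1 b2 κb Ψ : ℝ → ℝ} (hS : 8 < S) (hν : 0 ≤ ν)
    (ha1 : ∀ r ∈ Ioo (-S) S, HasDerivAt a (a1 r) r)
    (ha2 : ∀ r ∈ Ioo (-S) S, HasDerivAt a1 (a2 r) r)
    (ha : ∀ r ∈ Icc (0 : ℝ) 8, r ^ 2 * a2 r + r * a1 r = a r - r ^ 2 * κa r)
    (ha0 : a 0 = 0) (ha10 : a1 0 = 0)
    (hb1 : ∀ r ∈ Ioo (-S) S, HasDerivAt b (b1 r) r)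
    (hb2 : ∀ r ∈ Ioo (-S) S, HasDerivAt b1 (b2 r) r)
    (hb : ∀ r ∈ Icc (0 : ℝ) 8, r ^ 2 * b2 r + r * b1 r = b r - r ^ 2 * κb r)
    (hb0 : b 0 = 0) (hb10 : b1 0 = 0)
    (hΨ : ContinuousOn Ψ (Icc 0 8)) (hΨ0 : ∀ r ∈ Icc (0 : ℝ) 8, 0 ≤ Ψ r)
    (hκa : ∀ r ∈ Icc (0 : ℝ) 8,
      |κa r| ≤ 3 * |a r| + 3 * (Ψ r + 2 * a r ^ 2 + 2 * b r ^ 2) + 2 * ν)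
    (hκb : ∀ r ∈ Icc (0 : ℝ) 8,
      |κb r| ≤ 3 * |b r| + 3 * (Ψ r + 2 * a r ^ 2 + 2 * b r ^ 2) + 2 * ν)
    (hsa : ∀ r ∈ Icc (0 : ℝ) 8, |a r| ≤ 1 / 10) (hsb : ∀ r ∈ Icc (0 : ℝ) 8, |b r| ≤ 1 / 10)
    {r : ℝ} (hr : r ∈ Icc (0 : ℝ) 8) :
    |a r| + |b r| ≤ 128 * exp 256 * ((∫ t in (0 : ℝ)..8, Ψ t) + ν) := by
  have mem : ∀ r ∈ Icc (0 : ℝ) 8, r ∈ Ioo (-S) S := fun r hr =>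
    ⟨by linarith [hr.1], by linarith [hr.2]⟩
  have ca : ContinuousOn a (Icc 0 8) := fun r hr =>
    (ha1 r (mem r hr)).continuousAt.continuousWithinAt
  have cb : ContinuousOn b (Icc 0 8) := fun r hr =>
    (hb1 r (mem r hr)).continuousAt.continuousWithinAt
  obtain ⟨K, cK, eK, rK⟩ := exists_continuous_extend (R := 8) (by norm_num)
    (K := fun r => 3 * (|a r| + |b r|) + 3 * (Ψ r + 2 * a r ^ 2 + 2 * b r ^ 2) + 2 * ν)
    (by fun_prop)
  obtain ⟨Q, cQ, eQ, rQ⟩ := exists_continuous_extend (R := 8) (by norm_num) hΨ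
  have K0 : ∀ r, 0 ≤ K r := fun r => by
    obtain ⟨s, hs, e⟩ := rK r
    have := hΨ0 s hs
    rw [e]; positivity
  have Q0 : ∀ r, 0 ≤ Q r := fun r => by
    obtain ⟨s, hs, e⟩ := rQ r
    rw [e]; exact hΨ0 s hs
  set H : ℝ → ℝ := fun r => ∫ t in (0 : ℝ)..r, K t with hH
  have dH : ∀ r, HasDerivAt H (K r) r := fun r => cK.integral_hasStrictDerivAt 0 r |>.hasDerivAt
  set J : ℝ → ℝ := fun r => ∫ t in (0 : ℝ)..r, Q t with hJ
  have dJ : ∀ r, HasDerivAt J (Q r) r := fun r => cQ.integral_hasStrictDerivAt 0 r |>.hasDerivAt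
  have A : ∀ r ∈ Icc (0 : ℝ) 8, |a r| + |b r| ≤ 8 * H r := fun r hr => by
    have i1 := abs_mode_le hS ha1 ha2 ha ha0 ha10 cK (fun r hr => by
      rw [eK r hr]; exact (hκa r hr).trans (by linarith [abs_nonneg (b r)])) K0 hr
    have i2 := abs_mode_le hS hb1 hb2 hb hb0 hb10 cK (fun r hr => by
      rw [eK r hr]; exact (hκb r hr).trans (by linarith [abs_nonneg (a r)])) K0 hr
    have : 0 ≤ H r := intervalIntegral.integral_nonneg hr.1 fun t _ => K0 t
    have h8 := hr.2
    change _ ≤ r / 2 * H r at i1 i2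
    nlinarith
  have Kle : ∀ r ∈ Icc (0 : ℝ) 8, K r ≤ 32 * H r + 3 * Q r + 2 * ν := fun r hr => by
    rw [eK r hr, eQ r hr]
    have := A r hr
    have j1 : a r ^ 2 ≤ |a r| / 10 := by
      rw [← sq_abs]; nlinarith [hsa r hr, abs_nonneg (a r)]
    have j2 : b r ^ 2 ≤ |b r| / 10 := by
      rw [← sq_abs]; nlinarith [hsb r hr, abs_nonneg (b r)]
    linarith [abs_nonneg (a r), abs_nonneg (b r)]
  have anti : AntitoneOn (fun r => exp (-32 * r) * H r - (3 * J r + 2 * ν * r)) (Icc 0 8) := by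
    have dd : ∀ r, HasDerivAt (fun r => exp (-32 * r) * H r - (3 * J r + 2 * ν * r))
        (exp (-32 * r) * (K r - 32 * H r) - (3 * Q r + 2 * ν)) r := fun r => by
      have i := hasDerivAt_id r
      refine ((((i.const_mul (-32)).exp.mul (dH r)).sub
        (((dJ r).const_mul 3).add (i.const_mul (2 * ν))))).congr_deriv ?_
      simp; ring
    refine antitoneOn_of_hasDerivWithinAt_nonpos (convex_Icc 0 8)
      (fun r hr => (dd r).continuousAt.continuousWithinAt)
      (fun r hr => (dd r).hasDerivWithinAt) fun r hr => ?_
    have hr' := interior_subset hr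
    have k1 := Kle r hr'
    have k2 : exp (-32 * r) ≤ 1 := exp_le_one_iff.2 (by linarith [hr'.1])
    have k3 := exp_pos (-32 * r)
    have k4 := Q0 r
    nlinarith
  have h0 := anti (left_mem_Icc.2 (by norm_num)) (right_mem_Icc.2 (by norm_num)) (by norm_num)
  have H0 : H 0 = 0 := by simp [hH]
  have J0 : J 0 = 0 := by simp [hJ]
  have J8 : J 8 = ∫ t in (0 : ℝ)..8, Ψ t := intervalIntegral.integral_congr fun t ht => by
    rw [uIcc_of_le (by norm_num)] at ht
    exact eQ t ht
  have Jn : 0 ≤ J 8 := intervalIntegral.integral_nonneg (by norm_num) fun t _ => Q0 t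
  simp only [H0, J0, mul_zero, zero_add, sub_zero] at h0
  have h8 : H 8 ≤ exp 256 * (3 * J 8 + 2 * ν * 8) := by
    have e : exp 256 * exp (-32 * 8) = 1 := by rw [← exp_add]; norm_num
    calc H 8 = exp 256 * (exp (-32 * 8) * H 8) := by rw [← mul_assoc, e, one_mul]
      _ ≤ _ := mul_le_mul_of_nonneg_left (by linarith) (exp_pos _).le
  have hmono : H r ≤ H 8 := by
    have : MonotoneOn H (Icc 0 8) := monotoneOn_of_hasDerivWithinAt_nonneg (convex_Icc 0 8)
      (fun r hr => (dH r).continuousAt.continuousWithinAt)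
      (fun r hr => (dH r).hasDerivWithinAt) fun r hr => K0 r
    exact this hr (right_mem_Icc.2 (by norm_num)) hr.2
  rw [← J8]
  have e0 := exp_pos (256 : ℝ)
  have : exp 256 * (3 * J 8 + 2 * ν * 8) ≤ exp 256 * (16 * (J 8 + ν)) :=
    mul_le_mul_of_nonneg_left (by linarith) e0.le
  linarith [A r hr]

/-- The weight `-d/dr (r² e^{2U})` with `U(r) = -log (1 + r² / 4)`. -/
def wgt (r : ℝ) : ℝ := 2 * r * (r ^ 2 / 4 - 1) / (1 + r ^ 2 / 4) ^ 3

lemma continuous_wgt : Continuous wgt := by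
  unfold wgt
  refine Continuous.div (by fun_prop) (by fun_prop) fun r => ?_
  positivity

lemma integral_wgt_mul_id {a b : ℝ} : ∫ r in a..b, wgt r * r =
    (-(b * (b ^ 2 / (1 + b ^ 2 / 4) ^ 2)) + 4 * arctan (b / 2) - 2 * b / (1 + b ^ 2 / 4)) -
    (-(a * (a ^ 2 / (1 + a ^ 2 / 4) ^ 2)) + 4 * arctan (a / 2) - 2 * a / (1 + a ^ 2 / 4)) := by
  refine intervalIntegral.integral_eq_sub_of_hasDerivAt
    (f := fun b => -(b * (b ^ 2 / (1 + b ^ 2 / 4) ^ 2)) + 4 * arctan (b / 2)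
      - 2 * b / (1 + b ^ 2 / 4)) (fun r _ => ?_)
    ((continuous_wgt.mul continuous_id).intervalIntegrable _ _)
  have i := hasDerivAt_id r
  have hx : 1 + r ^ 2 / 4 ≠ 0 := by positivity
  have dx := ((i.pow 2).div_const 4).const_add 1
  refine (((i.mul ((i.pow 2).div (dx.pow 2) (pow_ne_zero 2 hx))).neg.add
    ((i.div_const 2).arctan.const_mul 4)).sub ((i.const_mul 2).div dx hx)).congr_deriv ?_
  have h4 : 4 + r ^ 2 ≠ 0 := by positivity
  simp only [id, wgt, Pi.pow_apply, Pi.div_apply]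
  field_simp
  push_cast
  ring

lemma wgt_ge {r : ℝ} (hr : r ∈ Icc (4 : ℝ) 8) : 1 / 25 ≤ wgt r := by
  unfold wgt
  rw [le_div_iff₀ (by positivity)]
  obtain ⟨h1, h2⟩ := hr
  set x := 1 + r ^ 2 / 4 with hx
  have e : r ^ 2 / 4 - 1 = x - 2 := by rw [hx]; ring
  rw [e]
  have a1 : x ≤ 17 / 8 * r := by nlinarith
  have a2 : 5 ≤ x := by nlinarith
  have a3 : x ≤ 17 := by nlinarith
  have a4 : 17 / 8 * x ^ 2 ≤ 50 * (x - 2) := by nlinarith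
  have a5 : x ^ 3 ≤ x ^ 2 * (17 / 8 * r) := by nlinarith [sq_nonneg x]
  nlinarith

/-- Chebyshev type inequality for the weight `wgt`. -/
lemma integral_wgt_mul_ge {X : ℝ → ℝ} (hX : ContinuousOn X (Icc 0 8))
    (hX0 : ∀ r ∈ Icc (0 : ℝ) 8, 0 ≤ X r)
    (hm : ∀ s t : ℝ, 0 < s → s ≤ t → t ≤ 8 → X s * t ≤ X t * s) :
    1 / 50 * ∫ r in (0 : ℝ)..8, X r ≤ ∫ r in (0 : ℝ)..8, wgt r * X r := by
  set P := X 2 / 2 with hP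
  have P0 : 0 ≤ P := by have := hX0 2 (by constructor <;> norm_num); positivity
  have below : ∀ r, 0 < r → r ≤ 2 → X r ≤ P * r := fun r h0 h2 => by
    have := hm r 2 h0 h2 (by norm_num); rw [hP]; linarith
  have above : ∀ r, 2 ≤ r → r ≤ 8 → P * r ≤ X r := fun r h0 h2 => by
    have := hm 2 r (by norm_num) h0 h2; rw [hP]; linarith
  have i1 : ∀ {a b : ℝ}, 0 ≤ a → a ≤ b → b ≤ 8 → IntervalIntegrable X volume a b :=
    fun ha hab hb => (hX.mono (by rw [uIcc_of_le hab]; exact Icc_subset_Icc ha hb)).intervalIntegrable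
  have i2 : ∀ {a b : ℝ}, 0 ≤ a → a ≤ b → b ≤ 8 →
      IntervalIntegrable (fun r => wgt r * X r) volume a b :=
    fun ha hab hb => ((continuous_wgt.continuousOn.mul hX).mono
      (by rw [uIcc_of_le hab]; exact Icc_subset_Icc ha hb)).intervalIntegrable
  have i3 : ∀ a b : ℝ, IntervalIntegrable (fun r => P * (wgt r * r)) volume a b :=
    fun a b => (continuous_const.mul (continuous_wgt.mul continuous_id)).intervalIntegrable _ _
  have L1 : ∫ r in (0 : ℝ)..4, P * (wgt r * r) ≤ ∫ r in (0 : ℝ)..4, wgt r * X r := by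
    refine intervalIntegral.integral_mono_on (by norm_num) (i3 _ _)
      (i2 le_rfl (by norm_num) (by norm_num)) fun r hr => ?_
    rcases hr.1.eq_or_lt with h0 | h0
    · rw [← h0]; simp [wgt]
    · have hx : 0 < (1 + r ^ 2 / 4) ^ 3 := by positivity
      rcases le_total r 2 with h2 | h2
      · have : wgt r ≤ 0 := div_nonpos_of_nonpos_of_nonneg
          (mul_nonpos_of_nonneg_of_nonpos (by positivity) (by nlinarith)) hx.le
        nlinarith [below r h0 h2]
      · have : 0 ≤ wgt r := div_nonneg (mul_nonneg (by positivity) (by nlinarith)) hx.le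
        nlinarith [above r h2 (by linarith [hr.2])]
  have L2 : ∫ r in (4 : ℝ)..8, (P * (wgt r * r) + (1 / 25 * X r - 1 / 25 * (P * r)))
      ≤ ∫ r in (4 : ℝ)..8, wgt r * X r := by
    refine intervalIntegral.integral_mono_on (by norm_num) ((i3 _ _).add
      (((i1 (by norm_num) (by norm_num) le_rfl).const_mul _).sub
        (Continuous.intervalIntegrable (by fun_prop) _ _)))
      (i2 (by norm_num) (by norm_num) (by norm_num)) fun r hr => ?_
    have := above r (by linarith [hr.1]) hr.2
    nlinarith [wgt_ge hr]
  rw [intervalIntegral.integral_add (i3 _ _)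
      (((i1 (by norm_num) (by norm_num) le_rfl).const_mul _).sub
        (Continuous.intervalIntegrable (by fun_prop) _ _)),
    intervalIntegral.integral_sub ((i1 (by norm_num) (by norm_num) le_rfl).const_mul _)
        (Continuous.intervalIntegrable (by fun_prop) _ _),
    intervalIntegral.integral_const_mul, intervalIntegral.integral_const_mul,
    intervalIntegral.integral_const_mul, intervalIntegral.integral_const_mul, integral_id] at L2
  rw [intervalIntegral.integral_const_mul] at L1
  have M1 : ∫ r in (0 : ℝ)..4, X r ≤ ∫ r in (0 : ℝ)..4, X 4 := by
    refine intervalIntegral.integral_mono_on (by norm_num) (i1 le_rfl (by norm_num) (by norm_num))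
      intervalIntegrable_const fun r hr => ?_
    rcases hr.1.eq_or_lt with h0 | h0
    · have : ContinuousWithinAt X (Ioc 0 8) 0 :=
        (hX 0 (by constructor <;> norm_num)).mono Ioc_subset_Icc_self
      have ne : (𝓝[Ioc (0 : ℝ) 8] 0).NeBot := by
        rw [nhdsWithin_Ioc_eq_nhdsGT (by norm_num : (0 : ℝ) < 8)]; infer_instance
      rw [← h0]
      refine le_of_tendsto this ?_
      have h4 : ∀ᶠ s in 𝓝[Ioc (0 : ℝ) 8] 0, s < 4 :=
        nhdsWithin_le_nhds (Iio_mem_nhds (by norm_num))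
      filter_upwards [self_mem_nhdsWithin, h4] with s hs hs4
      have := hm s 4 hs.1 hs4.le (by norm_num)
      have := hX0 4 (by constructor <;> norm_num)
      nlinarith
    · have := hm r 4 h0 hr.2 (by norm_num)
      have := hX0 4 (by constructor <;> norm_num)
      nlinarith [hr.2]
  have M2 : ∫ r in (4 : ℝ)..8, X 4 ≤ ∫ r in (4 : ℝ)..8, X r := by
    refine intervalIntegral.integral_mono_on (by norm_num) intervalIntegrable_const
      (i1 (by norm_num) (by norm_num) (by norm_num)) fun r hr => ?_
    have := hm 4 r (by norm_num) hr.1 hr.2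
    have := hX0 4 (by constructor <;> norm_num)
    nlinarith [hr.1]
  rw [intervalIntegral.integral_const] at M1 M2
  have s1 := intervalIntegral.integral_add_adjacent_intervals
    (i1 le_rfl (by norm_num) (by norm_num) : IntervalIntegrable X volume 0 4)
    (i1 (by norm_num) (by norm_num) le_rfl : IntervalIntegrable X volume 4 8)
  have s2 := intervalIntegral.integral_add_adjacent_intervals
    (i2 le_rfl (by norm_num) (by norm_num) : IntervalIntegrable (fun r => wgt r * X r) volume 0 4)
    (i2 (by norm_num) (by norm_num) le_rfl : IntervalIntegrable (fun r => wgt r * X r) volume 4 8)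
  have s3 := intervalIntegral.integral_add_adjacent_intervals
    ((continuous_wgt.mul continuous_id).intervalIntegrable (μ := volume) 0 4)
    ((continuous_wgt.mul continuous_id).intervalIntegrable (μ := volume) 4 8)
  have tot : 1 ≤ ∫ r in (0 : ℝ)..8, wgt r * r := by
    rw [integral_wgt_mul_id]
    have a1 : arctan 4 = π / 2 - arctan (4⁻¹) := by
      rw [arctan_inv_of_pos (by norm_num)]; ring
    have a2 : arctan (4⁻¹ : ℝ) ≤ 4⁻¹ := by
      have := le_tan (arctan_nonneg.2 (by norm_num : (0 : ℝ) ≤ 4⁻¹)) (arctan_lt_pi_div_two _)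
      rwa [tan_arctan] at this
    have := Real.pi_gt_three
    rw [show (8 : ℝ) / 2 = 4 by norm_num, zero_div, arctan_zero, a1]
    norm_num at a2 ⊢
    linarith
  simp only [Pi.mul_apply, id] at s3
  rw [← s1, ← s2]
  norm_num at M1 M2 L2
  have : P * 1 ≤ P * ∫ r in (0 : ℝ)..8, wgt r * r := mul_le_mul_of_nonneg_left tot P0
  rw [← s3, mul_add] at this
  linarith

lemma log_seventeen_le : log 17 ≤ 2.84 := by
  have e : log 17 = 4 * log 2 + log (17 / 16) := by
    rw [show (17 : ℝ) = 2 ^ 4 * (17 / 16) by norm_num, log_mul (by norm_num) (by norm_num), log_pow]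
    norm_num
  have := Real.log_two_lt_d9
  have := Real.log_le_sub_one_of_pos (x := 17 / 16) (by norm_num)
  rw [e]; linarith

lemma integral_wgt_mul_log :
    1.15 ≤ ∫ r in (0 : ℝ)..8, wgt r * (log (1 + r ^ 2 / 4) ^ 2 - log (1 + r ^ 2 / 4)) := by
  set T : ℝ → ℝ := fun r => 4 * (-((log (1 + r ^ 2 / 4) ^ 2 + log (1 + r ^ 2 / 4) + 1)
    / (1 + r ^ 2 / 4)) + log (1 + r ^ 2 / 4) ^ 2 / (1 + r ^ 2 / 4) ^ 2) with hT
  have cl : Continuous fun r : ℝ => log (1 + r ^ 2 / 4) :=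
    Continuous.log (by fun_prop) fun r => by positivity
  have e := intervalIntegral.integral_eq_sub_of_hasDerivAt (a := 0) (b := 8) (f := T)
    (f' := fun r => wgt r * (log (1 + r ^ 2 / 4) ^ 2 - log (1 + r ^ 2 / 4))) (fun r _ => ?_)
    ((continuous_wgt.mul ((cl.pow 2).sub cl)).intervalIntegrable _ _)
  · rw [e]
    simp only [hT]
    norm_num
    have h1 := log_seventeen_le
    have h0 : 0 ≤ log 17 := log_nonneg (by norm_num)
    nlinarith [mul_nonneg h0 (sub_nonneg.2 h1)]
  · have i := hasDerivAt_id r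
    have hx : 1 + r ^ 2 / 4 ≠ 0 := by positivity
    have dx := ((i.pow 2).div_const 4).const_add 1
    have dl := dx.log hx
    refine ((((((dl.pow 2).add dl).add_const 1).div dx hx).neg.add
      ((dl.pow 2).div (dx.pow 2) (pow_ne_zero 2 hx))).const_mul 4).congr_deriv ?_
    have h4 : 4 + r ^ 2 ≠ 0 := by positivity
    simp only [id, wgt, Pi.pow_apply, Pi.add_apply]
    generalize log (1 + r ^ 2 / 4) = L
    field_simp
    push_cast
    ring

lemma abs_wgt_le {r : ℝ} (hr : 0 ≤ r) : |wgt r| ≤ 2 := by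
  unfold wgt
  set x := 1 + r ^ 2 / 4 with hx
  have e : r ^ 2 / 4 - 1 = x - 2 := by rw [hx]; ring
  have h1 : 1 ≤ x := by rw [hx]; nlinarith [sq_nonneg r]
  have hrx : r ≤ x := by rw [hx]; nlinarith [sq_nonneg (r / 2 - 1)]
  rw [e, abs_div, abs_of_nonneg (by positivity : 0 ≤ x ^ 3), div_le_iff₀ (by positivity), abs_mul,
    abs_of_nonneg (by positivity : 0 ≤ 2 * r)]
  have h2 : |x - 2| ≤ x := by rw [abs_le]; constructor <;> linarith
  calc 2 * r * |x - 2| ≤ 2 * x * x := by gcongr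
    _ ≤ 2 * x ^ 3 := by nlinarith [sq_nonneg x]

/-- The radial quantity `(1 - m)² + r² e^{2β}`, constant for the standard bubble. -/
def pohozaev (V Vr : ℝ → ℝ → ℝ) (r : ℝ) : ℝ :=
  (1 + r * cavg (Vr r)) ^ 2 + r ^ 2 * exp (2 * cavg (V r))

namespace PolarSolution

variable {S : ℝ} {V Vr Vrr Vt Vtt G : ℝ → ℝ → ℝ}

lemma hasDerivAt_pohozaev (h : PolarSolution S V Vr Vrr Vt Vtt G) {r : ℝ}
    (hr : r ∈ Ioo (-S) S) :
    HasDerivAt (pohozaev V Vr)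
      (2 * (-(r * cavg (Vr r)) - 1) * r * (cavg (G r) - exp (2 * cavg (V r)))) r := by
  have h1 := h.hasDerivAt_flux hr
  have h2 := h.hasDerivAt_mean hr
  have h3 : HasDerivAt (fun r => 1 + r * cavg (Vr r)) (-(r * cavg (G r))) r := by
    refine (h1.neg.const_add 1).congr_of_eventuallyEq (Eventually.of_forall fun r => ?_)
    simp
  refine ((h3.pow 2).add (((hasDerivAt_id r).pow 2).mul ((h2.const_mul 2).exp))).congr_deriv ?_
  simp
  ring

end PolarSolution

/-- The profile of the standard bubble as a function of the radius. -/
def bub (r : ℝ) : ℝ := -log (1 + r ^ 2 / 4)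

lemma bub_mem {r : ℝ} (hr : r ∈ Icc (0 : ℝ) 8) : bub r ∈ Icc (-3 : ℝ) 0 := by
  unfold bub
  have h1 : 1 ≤ 1 + r ^ 2 / 4 := by nlinarith [sq_nonneg r]
  have h2 : 1 + r ^ 2 / 4 ≤ 17 := by nlinarith [hr.1, hr.2]
  have := log_nonneg h1
  have := log_le_log (by positivity) h2
  constructor <;> linarith [log_seventeen_le]

lemma exp_two_bub (r : ℝ) : exp (2 * bub r) = 1 / (1 + r ^ 2 / 4) ^ 2 := by
  have hx : 0 < 1 + r ^ 2 / 4 := by positivity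
  unfold bub
  rw [show 2 * -log (1 + r ^ 2 / 4) = -(log (1 + r ^ 2 / 4) + log (1 + r ^ 2 / 4)) by ring,
    exp_neg, exp_add, exp_log hx]
  field_simp

lemma wgt_eq (r : ℝ) :
    wgt r = 2 * ((r ^ 2 / 2) / (1 + r ^ 2 / 4) - 1) * r * exp (2 * bub r) := by
  rw [exp_two_bub]; unfold wgt
  field_simp
  ring

/-- The flux of a function whose source is close to that of the bubble is close to the flux of
the bubble. -/
lemma PolarSolution.abs_flux_sub_le {S : ℝ} {V Vr Vrr Vt Vtt G : ℝ → ℝ → ℝ}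
    (h : PolarSolution S V Vr Vrr Vt Vtt G) (hS : 8 < S) {τ : ℝ}
    (hG : ∀ r ∈ Icc (0 : ℝ) 8, |cavg (G r) - exp (2 * bub r)| ≤ τ) {r : ℝ}
    (hr : r ∈ Icc (0 : ℝ) 8) :
    |-(r * cavg (Vr r)) - (r ^ 2 / 2) / (1 + r ^ 2 / 4)| ≤ 64 * τ := by
  have mem : ∀ r ∈ Icc (0 : ℝ) 8, r ∈ Ioo (-S) S := fun r hr =>
    ⟨by linarith [hr.1], by linarith [hr.2]⟩
  have hd : ∀ r ∈ Icc (0 : ℝ) 8, HasDerivAt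
      (fun r => -(r * cavg (Vr r)) - (r ^ 2 / 2) / (1 + r ^ 2 / 4))
      (r * (cavg (G r) - exp (2 * bub r))) r := fun r hr => by
    have hx : 1 + r ^ 2 / 4 ≠ 0 := by positivity
    have i := (hasDerivAt_id r).pow 2
    refine ((h.hasDerivAt_flux (mem r hr)).sub
      ((i.div_const 2).div ((i.div_const 4).const_add 1) hx)).congr_deriv ?_
    rw [exp_two_bub]
    simp
    field_simp
    ring
  have τ0 : 0 ≤ τ := (abs_nonneg _).trans (hG r hr)
  have := (convex_Icc (0 : ℝ) 8).norm_image_sub_le_of_norm_hasDerivWithin_le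
    (fun t ht => (hd t ht).hasDerivWithinAt) (C := 8 * τ) (fun t ht => by
      rw [Real.norm_eq_abs, abs_mul, abs_of_nonneg ht.1]
      exact mul_le_mul ht.2 (hG t ht) (abs_nonneg _) (by norm_num))
      (left_mem_Icc.2 (by norm_num)) hr
  simp only [Real.norm_eq_abs, abs_of_nonneg hr.1, sub_zero] at this
  norm_num at this
  refine this.trans ?_
  nlinarith [hr.2]

set_option maxHeartbeats 1000000 in
lemma pohozaev_deriv_ge {m m0 r E A k δ ν σ Ψ κ w U : ℝ} (hr : r ∈ Icc (0 : ℝ) 8)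
    (hm0 : |m0 - 1| ≤ 1) (hm : |m - m0| ≤ 200 * δ) (hδ : 0 < δ) (hδ1 : δ ≤ 1 / 10000000)
    (hE0 : 0 < E) (hE1 : E ≤ 1) (hw : w = 2 * (m0 - 1) * r * E) (hw2 : |w| ≤ 2) (hk : 0 < k)
    (hν : 0 ≤ ν) (hσ : 0 ≤ σ) (hΨ : 0 ≤ Ψ) (hκ : 0 ≤ κ) (hU : U ∈ Icc (-3 : ℝ) 0)
    (hA : |A - k * (E * (U ^ 2 + U)) - 2 * E * (Ψ + 2 * σ)|
      ≤ δ * (Ψ + 2 * σ) + δ * k + 2 * ν) :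
    k * (w * (U ^ 2 + U)) + 2 * (w * (Ψ + κ * r ^ 2)) - 256 * κ - 9 * σ - 100000 * δ * (Ψ + k)
      - 100 * ν ≤ 2 * (m - 1) * r * A := by
  set Φ := Ψ + 2 * σ with hΦ
  have hΦ0 : 0 ≤ Φ := by positivity
  set T := k * (E * (U ^ 2 + U)) + 2 * E * Φ with hT
  have hUU : |U ^ 2 + U| ≤ 6 := by
    rw [abs_le]; constructor <;> nlinarith [hU.1, hU.2, sq_nonneg (U + 1 / 2)]
  have hTb : |T| ≤ 6 * k + 2 * Φ := by
    rw [abs_le] at hUU ⊢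
    have a1 : k * E * (U ^ 2 + U) ≤ k * 1 * 6 := by
      have : k * E ≤ k * 1 := by gcongr
      have h0 : 0 < k * E := by positivity
      nlinarith
    have a2 : -(k * 1 * 6) ≤ k * E * (U ^ 2 + U) := by
      have : k * E ≤ k * 1 := by gcongr
      have h0 : 0 < k * E := by positivity
      nlinarith
    have a3 : E * Φ ≤ 1 * Φ := by gcongr
    have a4 : 0 ≤ E * Φ := by positivity
    constructor <;> nlinarith
  have hAT : |A - T| ≤ δ * Φ + δ * k + 2 * ν := by
    convert hA using 2; rw [hT]; ring
  have e : 2 * (m - 1) * r * A = k * (w * (U ^ 2 + U)) + 2 * w * Φ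
      + 2 * (m - m0) * r * T + 2 * (m - 1) * r * (A - T) := by
    rw [hw, hT]; ring
  have b1 : |2 * (m - m0) * r * T| ≤ 2 * (200 * δ) * 8 * (6 * k + 2 * Φ) := by
    rw [abs_mul, abs_mul, abs_mul, abs_of_nonneg hr.1]
    have := hr.2
    have := hr.1
    norm_num
    gcongr
  have hm1 : |m - 1| ≤ 2 := by
    have := abs_add_le (m - m0) (m0 - 1)
    have e : m - m0 + (m0 - 1) = m - 1 := by ring
    rw [e] at this
    linarith
  have b2 : |2 * (m - 1) * r * (A - T)| ≤ 2 * 2 * 8 * (δ * Φ + δ * k + 2 * ν) := by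
    rw [abs_mul, abs_mul, abs_mul, abs_of_nonneg hr.1]
    have := hr.2
    have := hr.1
    rw [abs_of_pos (by norm_num : (0 : ℝ) < 2)]
    have : 2 * |m - 1| * r ≤ 2 * 2 * 8 := by gcongr
    exact mul_le_mul this hAT (abs_nonneg _) (by norm_num)
  have b1 := (abs_le.1 b1).1
  have b2 := (abs_le.1 b2).1
  have hw' := abs_le.1 hw2
  have b3 : -(8 * σ) ≤ 4 * w * σ := by
    linarith [mul_le_mul_of_nonneg_right hw'.1 hσ]
  have b4 : 2 * (w * (κ * r ^ 2)) ≤ 256 * κ := by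
    have h64 : r ^ 2 ≤ 64 := by nlinarith [hr.1, hr.2]
    have : w * (κ * r ^ 2) ≤ 2 * (κ * 64) := by
      have h0 : 0 ≤ κ * r ^ 2 := by positivity
      have h1 : κ * r ^ 2 ≤ κ * 64 := by gcongr
      linarith [mul_le_mul_of_nonneg_right hw'.2 h0]
    linarith
  have b5 : δ * σ ≤ 1 / 10000000 * σ := by gcongr
  have b6 : δ * Φ = δ * Ψ + 2 * (δ * σ) := by rw [hΦ]; ring
  have b7 : 0 ≤ δ * Ψ := by positivity
  have b8 : 0 ≤ δ * k := by positivity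
  have b9 : w * Φ = w * Ψ + 2 * (w * σ) := by rw [hΦ]; ring
  rw [e]
  linarith

set_option maxHeartbeats 1000000 in
/-- The gain of the radial quantity across the bubble. -/
lemma pohozaev_gain : ∃ ε > 0, ε ≤ 1 / 10000 ∧ ∀ k ν S : ℝ, 0 < k → k ≤ ε → 0 ≤ ν → ν ≤ ε * k →
    8 < S → ∀ F V Vr Vrr Vt Vtt : ℝ → ℝ → ℝ,
    PolarSolution S V Vr Vrr Vt Vtt (fun r θ => F r θ * nl k (V r θ)) →
    (∀ r ∈ Icc (0 : ℝ) 8, Continuous (F r)) →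
    (∀ r ∈ Icc (0 : ℝ) 8, ∀ θ, |F r θ - 1| ≤ ν) →
    (∀ r ∈ Icc (0 : ℝ) 8, ∀ θ, |V r θ - bub r| ≤ ε) →
    1 + k ≤ pohozaev V Vr 8 ∧ 3 / 2 ≤ -(8 * cavg (Vr 8)) ∧ |cavg (V 8) + log 17| ≤ 1 / 10000 := by
  set C0 : ℝ := 128 * exp 256 with hC0
  have C01 : 1 ≤ C0 := by
    have := one_le_exp (x := 256) (by norm_num)
    linarith
  set δ : ℝ := 1 / 10000000 / C0 with hδ
  have δ0 : 0 < δ := by positivity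
  have δ1 : δ ≤ 1 / 10000000 := div_le_self (by norm_num) C01
  have δC : δ * C0 = 1 / 10000000 := by rw [hδ]; field_simp
  obtain ⟨η, η0, ηδ, H⟩ := slice_estimates δ0 (by linarith)
  refine ⟨min η (δ / 100000), by positivity,
    (min_le_right _ _).trans (by linarith), ?_⟩
  intro k ν S hk hkε hν hνε hS F V Vr Vrr Vt Vtt h hF hF1 hV
  have ε1 : min η (δ / 100000) ≤ η := min_le_left _ _
  have ε2 : min η (δ / 100000) ≤ δ / 100000 := min_le_right _ _
  have hk1 : k ≤ 1 := by linarith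
  have hν6 : ν ≤ 1 / 1000000 * k := hνε.trans (by gcongr; linarith)
  have hνδ : ν ≤ δ / 100000 := hνε.trans (by
    calc _ ≤ δ / 100000 * 1 := by gcongr
      _ = _ := by ring)
  have mem : ∀ r ∈ Icc (0 : ℝ) 8, r ∈ Ioo (-S) S := fun r hr =>
    ⟨by linarith [hr.1], by linarith [hr.2]⟩
  have Hs := fun r (hr : r ∈ Icc (0 : ℝ) 8) => H k ⟨hk.le, hkε.trans ε1⟩ (bub r) (bub_mem hr) ν
    (V r) (F r) (continuous_slice h.cV (mem r hr)) (hF r hr)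
    (fun θ => (hV r hr θ).trans ε1) (hF1 r hr)
  obtain ⟨d, dd, hd, hdd, hineq⟩ := h.psi_ineq
  set p : ℝ → ℝ := fun r => cavg (fun θ => V r θ * cos θ) with hp
  set q : ℝ → ℝ := fun r => cavg (fun θ => V r θ * sin θ) with hq
  have hΨ0 : ∀ r ∈ Icc (0 : ℝ) 8, 0 ≤ psi V r := fun r hr => by
    have := cavg_bessel (continuous_slice h.cV (mem r hr))
    unfold psi; linarith
  have hΦ : ∀ r, cavg (fun θ => V r θ ^ 2) - cavg (V r) ^ 2
      = psi V r + 2 * p r ^ 2 + 2 * q r ^ 2 := fun r => by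
    simp only [hp, hq, psi]; ring
  have hΨ : ∀ r, cavg (fun θ => V r θ ^ 2) - cavg (V r) ^ 2
      - 2 * cavg (fun θ => V r θ * cos θ) ^ 2 - 2 * cavg (fun θ => V r θ * sin θ) ^ 2
      = psi V r := fun r => rfl
  have cΨ : ContinuousOn (psi V) (Icc 0 8) := fun r hr =>
    (hd r (mem r hr)).continuousAt.continuousWithinAt
  set J := ∫ t in (0 : ℝ)..8, psi V t with hJ
  have J0 : 0 ≤ J := intervalIntegral.integral_nonneg (by norm_num) hΨ0
  have m0 : (0 : ℝ) ∈ Icc (0 : ℝ) 8 := by constructor <;> norm_num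
  have hV0 : V 0 = fun _ => 0 := funext h.center
  have hVr0 : Vr 0 = fun _ => 0 := funext h.centerr
  have hpq : ∀ r ∈ Icc (0 : ℝ) 8, |p r| + |q r| ≤ C0 * (J + ν) := fun r hr =>
    modes_gronwall hS hν (fun r hr => h.hasDerivAt_mode continuous_cos hr)
      (fun r hr => h.hasDerivAt_mode_deriv continuous_cos hr)
      (fun r hr => h.mode_eq hasDerivAt_cos (fun θ => (hasDerivAt_sin θ).neg) (by simp) (by simp)
        (mem r hr))
      (by simp [hV0, cavg_const]) (by simp [hVr0, cavg_const])
      (fun r hr => h.hasDerivAt_mode continuous_sin hr)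
      (fun r hr => h.hasDerivAt_mode_deriv continuous_sin hr)
      (fun r hr => h.mode_eq hasDerivAt_sin hasDerivAt_cos (by simp) (by simp) (mem r hr))
      (by simp [hV0, cavg_const]) (by simp [hVr0, cavg_const]) cΨ hΨ0
      (fun r hr => by
        have := (Hs r hr).2.2.2.2.2.1
        rwa [hΦ] at this)
      (fun r hr => by
        have := (Hs r hr).2.2.2.2.2.2.1
        rwa [hΦ] at this)
      (fun r hr => (Hs r hr).2.1.trans (by linarith))
      (fun r hr => (Hs r hr).2.2.1.trans (by linarith)) hr
  set σ := 1 / 1000000000 * (J + ν) with hσ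
  have σ0 : 0 ≤ σ := by positivity
  have hσr : ∀ r ∈ Icc (0 : ℝ) 8, p r ^ 2 + q r ^ 2 ≤ σ := fun r hr => by
    have a1 : |p r| ≤ η := (Hs r hr).2.1
    have a2 : |q r| ≤ η := (Hs r hr).2.2.1
    have a3 : p r ^ 2 + q r ^ 2 ≤ η * (|p r| + |q r|) := by
      rw [← sq_abs (p r), ← sq_abs (q r)]
      nlinarith [abs_nonneg (p r), abs_nonneg (q r)]
    calc _ ≤ η * (|p r| + |q r|) := a3
      _ ≤ (δ / 400) * (C0 * (J + ν)) := by gcongr; exact hpq r hr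
      _ = (δ * C0) / 400 * (J + ν) := by ring
      _ ≤ σ := by
        rw [δC, hσ]
        apply mul_le_mul_of_nonneg_right (by norm_num) (by positivity)
  set κ := 2 * (δ * σ + 2 * ν) with hκ
  have κ0 : 0 ≤ κ := by positivity
  have hE1 : ∀ r, exp (2 * bub r) ≤ 1 := fun r => by
    rw [exp_two_bub]
    apply div_le_one_of_le₀ _ (by positivity)
    exact one_le_pow₀ (by nlinarith [sq_nonneg r])
  have hrE : ∀ r : ℝ, 0 ≤ r → r ^ 2 * exp (2 * bub r) ≤ 1 := fun r hr => by
    rw [exp_two_bub, mul_one_div]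
    apply div_le_one_of_le₀ _ (by positivity)
    apply pow_le_pow_left₀ hr
    nlinarith [sq_nonneg (r / 2 - 1)]
  have hX : ∀ s t : ℝ, 0 < s → s ≤ t → t ≤ 8 →
      (psi V s + κ * s ^ 2) * t ≤ (psi V t + κ * t ^ 2) * s := by
    intro s t hs hst ht
    refine div_mono_of_subsolution hS κ0 hd hdd (fun r hr => ?_) hs hst ht
    refine le_trans ?_ (hineq r (mem r hr))
    have a := (Hs r hr).2.2.2.2.2.2.2
    rw [hΨ] at a
    have b := hσr r hr
    have b0 : 0 ≤ p r ^ 2 + q r ^ 2 := by positivity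
    simp only [hp, hq] at b b0
    have r0 : 0 ≤ 2 * r ^ 2 := by positivity
    have a' := mul_le_mul_of_nonneg_left a r0
    have Ψ0 := hΨ0 r hr
    have c1 : 2 * r ^ 2 * (2 * exp (2 * bub r) * psi V r) ≤ 4 * psi V r := by
      have := mul_le_mul_of_nonneg_right (hrE r hr.1) Ψ0
      linarith
    have h64 : r ^ 2 ≤ 64 := by nlinarith [hr.1, hr.2]
    have c2 : 2 * r ^ 2 * (δ * psi V r) ≤ 1 * psi V r := by
      have : 2 * r ^ 2 * δ ≤ 1 := by nlinarith
      have := mul_le_mul_of_nonneg_right this Ψ0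
      linarith
    have c3 : 2 * r ^ 2 * (δ * (cavg (fun θ => V r θ * cos θ) ^ 2
        + cavg (fun θ => V r θ * sin θ) ^ 2) + 2 * ν) ≤ κ * r ^ 2 := by
      rw [hκ]
      have : δ * (cavg (fun θ => V r θ * cos θ) ^ 2
        + cavg (fun θ => V r θ * sin θ) ^ 2) ≤ δ * σ := mul_le_mul_of_nonneg_left b δ0.le
      have := mul_le_mul_of_nonneg_left this r0
      linarith
    linarith
  have hτ : ∀ r ∈ Icc (0 : ℝ) 8, |-(r * cavg (Vr r)) - (r ^ 2 / 2) / (1 + r ^ 2 / 4)|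
      ≤ 200 * δ := fun r hr => by
    refine (h.abs_flux_sub_le hS (fun r hr => (Hs r hr).2.2.2.1) hr).trans ?_
    linarith
  have hb8 := (Hs 8 (by constructor <;> norm_num)).1
  refine ⟨?_, ?_, ?_⟩
  · -- integrate the derivative of the radial quantity
    have cX : ContinuousOn (fun r => psi V r + κ * r ^ 2) (Icc 0 8) := by fun_prop
    have ch := integral_wgt_mul_ge cX (fun r hr => by have := hΨ0 r hr; positivity) hX
    have pw : ∀ r ∈ Icc (0 : ℝ) 8,
        k * (wgt r * (log (1 + r ^ 2 / 4) ^ 2 - log (1 + r ^ 2 / 4)))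
          + 2 * (wgt r * (psi V r + κ * r ^ 2))
          - (256 * κ + 9 * σ + 100000 * δ * k + 100 * ν) - 100000 * δ * psi V r ≤
        2 * (-(r * cavg (Vr r)) - 1) * r
          * (cavg (fun θ => F r θ * nl k (V r θ)) - exp (2 * cavg (V r))) := fun r hr => by
      have hx : 0 < 1 + r ^ 2 / 4 := by positivity
      have a := (Hs r hr).2.2.2.2.1
      rw [hΦ] at a
      have := pohozaev_deriv_ge (m0 := (r ^ 2 / 2) / (1 + r ^ 2 / 4)) (σ := p r ^ 2 + q r ^ 2)
        hr (by
          rw [div_sub_one hx.ne', abs_div, abs_of_pos hx]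
          apply div_le_one_of_le₀ _ hx.le
          rw [abs_le]; constructor <;> nlinarith [sq_nonneg r]) (hτ r hr) δ0 δ1
        (exp_pos (2 * bub r)) (hE1 r) (wgt_eq r) (abs_wgt_le hr.1) hk hν (by positivity)
        (hΨ0 r hr) κ0 (bub_mem hr)
        (A := cavg (fun θ => F r θ * nl k (V r θ)) - exp (2 * cavg (V r))) (by
          rw [show psi V r + 2 * (p r ^ 2 + q r ^ 2) = psi V r + 2 * p r ^ 2 + 2 * q r ^ 2 by ring]
          exact a)
      have e : bub r ^ 2 + bub r = log (1 + r ^ 2 / 4) ^ 2 - log (1 + r ^ 2 / 4) := by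
        unfold bub; ring
      rw [e] at this
      linarith [hσr r hr]
    have cl : Continuous fun r : ℝ => log (1 + r ^ 2 / 4) :=
      Continuous.log (by fun_prop) fun r => by positivity
    have cw := continuous_wgt
    have cm := continuousOn_cavg h.cV
    have cmr := continuousOn_cavg h.cVr
    have cG := continuousOn_cavg h.cG
    have sub : Icc (0 : ℝ) 8 ⊆ Ioo (-S) S := mem
    have uI : uIcc (0 : ℝ) 8 = Icc 0 8 := uIcc_of_le (by norm_num)
    have cq : ContinuousOn (fun r => 2 * (-(r * cavg (Vr r)) - 1) * r
          * (cavg (fun θ => F r θ * nl k (V r θ)) - exp (2 * cavg (V r)))) (uIcc 0 8) := by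
      rw [uI]
      have c1 := cm.mono sub
      have c2 := cmr.mono sub
      have c3 := cG.mono sub
      fun_prop
    have ftc := intervalIntegral.integral_eq_sub_of_hasDerivAt (a := 0) (b := 8)
      (f := pohozaev V Vr) (fun r hr => h.hasDerivAt_pohozaev (mem r (uI ▸ hr)))
      cq.intervalIntegrable
    have i1 : IntervalIntegrable (fun r : ℝ =>
        wgt r * (log (1 + r ^ 2 / 4) ^ 2 - log (1 + r ^ 2 / 4))) volume 0 8 :=
      (cw.mul ((cl.pow 2).sub cl)).intervalIntegrable _ _
    have i2 : IntervalIntegrable (fun r => wgt r * (psi V r + κ * r ^ 2)) volume 0 8 := by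
      apply ContinuousOn.intervalIntegrable
      rw [uI]; exact cw.continuousOn.mul cX
    have i3 : IntervalIntegrable (psi V) volume 0 8 := by
      apply ContinuousOn.intervalIntegrable
      rwa [uI]
    have mono := intervalIntegral.integral_mono_on (by norm_num)
      ((((i1.const_mul k).add (i2.const_mul 2)).sub intervalIntegrable_const).sub
        (i3.const_mul (100000 * δ))) cq.intervalIntegrable pw
    have hq0 : pohozaev V Vr 0 = 1 := by simp [pohozaev]
    rw [ftc, hq0, intervalIntegral.integral_sub
      (((i1.const_mul k).add (i2.const_mul 2)).sub intervalIntegrable_const)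
        (i3.const_mul (100000 * δ)),
      intervalIntegral.integral_sub ((i1.const_mul k).add (i2.const_mul 2))
        intervalIntegrable_const,
      intervalIntegral.integral_add (i1.const_mul k) (i2.const_mul 2),
      intervalIntegral.integral_const_mul, intervalIntegral.integral_const_mul,
      intervalIntegral.integral_const_mul, intervalIntegral.integral_const] at mono
    have i4 : IntervalIntegrable (fun r => psi V r + κ * r ^ 2) volume 0 8 := by
      apply ContinuousOn.intervalIntegrable
      rw [uI]; exact cX
    have JX : J ≤ ∫ r in (0 : ℝ)..8, (psi V r + κ * r ^ 2) :=
      intervalIntegral.integral_mono_on (by norm_num) i3 i4 fun r _ => by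
        have : 0 ≤ κ * r ^ 2 := by positivity
        linarith
    have lg := mul_le_mul_of_nonneg_left integral_wgt_mul_log hk.le
    rw [← hJ] at mono
    have dJ : δ * J ≤ 1 / 10000000 * J := by gcongr
    have dk : δ * k ≤ 1 / 10000000 * k := by gcongr
    have dσ : δ * σ ≤ 1 / 10000000 * σ := by gcongr
    simp only [smul_eq_mul] at mono
    linarith
  · have := (abs_le.1 (hτ 8 (by constructor <;> norm_num))).1
    norm_num at this
    linarith
  · have e : bub 8 = -log 17 := by unfold bub; norm_num
    rw [e, sub_neg_eq_add] at hb8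
    linarith

lemma eventually_mul_exp_neg_le (A : ℝ) {a b : ℝ} (ha : 0 < a) (hb : 0 < b) :
    ∀ᶠ L in atTop, A * (L * exp (-(a * L))) ≤ b := by
  have h1 := (tendsto_pow_mul_exp_neg_atTop_nhds_zero 1).comp
    (tendsto_id.const_mul_atTop ha)
  have h2 := (h1.const_mul (A / a))
  rw [mul_zero] at h2
  filter_upwards [h2.eventually (eventually_le_nhds hb)] with L hL
  refine le_trans (le_of_eq ?_) hL
  simp only [Function.comp, id, pow_one]
  field_simp

/-- The nonlinearity dominates the Liouville nonlinearity at negative heights. -/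
lemma eventually_one_le_factor (Λ : ℝ) {c0 : ℝ} (hc0 : 0 < c0) :
    ∀ᶠ L in atTop, ∀ r y F : ℝ, 0 < r → 2 ≤ y → 3 / 2 * log r - 1 / 2 ≤ y → y ≤ L - 1 / 25 →
      1 - |Λ| * r * exp (-(L / 2)) ≤ F → c0 ≤ F → 1 ≤ F * ((1 - y / L) * exp (y ^ 2 / L)) := by
  filter_upwards [eventually_ge_atTop 10,
    eventually_mul_exp_neg_le (2 * |Λ|) (a := 1 / 4) (b := 1) (by norm_num) one_pos,
    eventually_mul_exp_neg_le 1 (a := 1 / 16) (b := c0 / 25) (by norm_num) (by positivity)]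
    with L hL h1 h2 r y F hr hy hyr hyL hF hFc
  have L0 : 0 < L := by linarith
  rcases le_total y (L / 4) with h | h
  · have hlog : log r ≤ L / 4 := by linarith
    have hre : r ≤ exp (L / 4) := by
      rw [← exp_log hr]; exact exp_le_exp.2 hlog
    have hF1 : 1 - |Λ| * exp (-(1 / 4 * L)) ≤ F := by
      have : |Λ| * r * exp (-(L / 2)) ≤ |Λ| * exp (L / 4) * exp (-(L / 2)) := by gcongr
      rw [mul_assoc, mul_assoc, ← exp_add, show L / 4 + -(L / 2) = -(1 / 4 * L) by ring] at this
      linarith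
    have hF2 : 1 - 1 / (2 * L) ≤ F := by
      have : |Λ| * exp (-(1 / 4 * L)) ≤ 1 / (2 * L) := by
        rw [le_div_iff₀ (by positivity)]; linarith
      linarith
    set t := y / L with ht
    have t1 : 2 / L ≤ t := by rw [ht]; gcongr
    have t2 : t ≤ 1 / 4 := by rw [ht, div_le_iff₀ L0]; linarith
    have t0 : 0 < t := lt_of_lt_of_le (by positivity) t1
    have e1 : 1 + 2 * t ≤ exp (y ^ 2 / L) := by
      have a := add_one_le_exp (y ^ 2 / L)
      have : y ^ 2 / L = y * t := by rw [ht]; ring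
      rw [this] at a ⊢
      nlinarith
    have e2 : 1 + 1 / L ≤ (1 - t) * exp (y ^ 2 / L) := by
      calc 1 + 1 / L ≤ (1 - t) * (1 + 2 * t) := by
            have : 1 / L ≤ t / 2 := by
              have : 2 / L = 2 * (1 / L) := by ring
              linarith
            nlinarith
        _ ≤ _ := by gcongr; linarith
    have iL : 1 / L ≤ 1 / 10 := by gcongr
    have iL0 : 0 < 1 / L := by positivity
    have e3 : 1 / (2 * L) = 1 / L / 2 := by field_simp
    rw [e3] at hF2
    calc (1 : ℝ) ≤ (1 - 1 / L / 2) * (1 + 1 / L) := by nlinarith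
      _ ≤ F * ((1 - t) * exp (y ^ 2 / L)) := by gcongr; linarith
  · have e0 : 1 / 25 / L ≤ 1 - y / L := by
      rw [div_le_iff₀ L0, sub_mul, div_mul_cancel₀ _ L0.ne']; linarith
    have e1 : exp (L / 16) ≤ exp (y ^ 2 / L) := by
      apply exp_le_exp.2
      rw [le_div_iff₀ L0]
      nlinarith
    have e2 : L ≤ c0 / 25 * exp (L / 16) := by
      rw [one_mul, exp_neg, ← div_eq_mul_inv, div_le_iff₀ (exp_pos _),
        show 1 / 16 * L = L / 16 by ring] at h2
      exact h2
    calc (1 : ℝ) ≤ c0 * (1 / 25 / L * exp (L / 16)) := by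
          rw [show c0 * (1 / 25 / L * exp (L / 16)) = c0 / 25 * exp (L / 16) / L by ring,
            le_div_iff₀ L0]
          linarith
      _ ≤ _ := by
        have f0 : 0 ≤ F := hc0.le.trans hFc
        have : 0 ≤ 1 - y / L := le_trans (by positivity) e0
        gcongr

/-- Jensen's inequality for the rescaled nonlinearity. -/
lemma nl_cavg_le {k : ℝ} (hk : 0 < k) {v : ℝ → ℝ} (hv : Continuous v)
    (h : ∀ θ, 0 ≤ 1 + k * v θ) : nl k (cavg v) ≤ cavg (fun θ => nl k (v θ)) := by
  have hs : {x : ℝ | 0 ≤ 1 + k * x} = Ici (-(1 / k)) := by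
    ext x
    have e : 1 + k * x = k * (x + 1 / k) := by field_simp; ring
    change 0 ≤ 1 + k * x ↔ -(1 / k) ≤ x
    rw [e, mul_nonneg_iff_of_pos_left hk, neg_le_iff_add_nonneg]
  have hb : 0 ≤ 1 + k * cavg v := by
    have := cavg_nonneg h
    rwa [cavg_add continuous_const (by fun_prop), cavg_const, cavg_const_mul] at this
  have ord : {x : ℝ | 0 ≤ 1 + k * x}.OrdConnected := hs ▸ ordConnected_Ici
  have T := fun θ => taylor_two_le (hasDerivAt_nl k) (hasDerivAt_nl' k) ord (c := 0)
    (fun x (hx : 0 ≤ 1 + k * x) => by unfold nl''; positivity) (x := cavg v) hb (h θ)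
  have cn := continuous_nl k
  have := cavg_mono (f := fun θ => nl k (cavg v) + nl' k (cavg v) * (v θ - cavg v))
    (by fun_prop) (by fun_prop) (fun θ => (by linarith [T θ] : _ ≤ nl k (v θ)))
  rwa [cavg_add continuous_const (by fun_prop), cavg_const, cavg_const_mul,
    cavg_sub hv continuous_const, cavg_const, sub_self, mul_zero, add_zero] at this

lemma le_of_hasDerivAt_nonneg {f f' : ℝ → ℝ} {a b : ℝ} (hab : a ≤ b)
    (h : ∀ x ∈ Icc a b, HasDerivAt f (f' x) x) (h0 : ∀ x ∈ Icc a b, 0 ≤ f' x) : f a ≤ f b := by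
  have := monotoneOn_of_hasDerivWithinAt_nonneg (convex_Icc a b)
    (fun x hx => (h x hx).continuousAt.continuousWithinAt)
    (fun x hx => (h x (interior_subset hx)).hasDerivWithinAt)
    (fun x hx => h0 x (interior_subset hx))
  exact this (left_mem_Icc.2 hab) (right_mem_Icc.2 hab) hab

/-- Integration of the differential inequality `(r y' - 1)² ≥ q - r² e^{-2y}`. -/
lemma log_growth {y m : ℝ → ℝ} {a b q : ℝ} (ha : 0 < a) (hab : a ≤ b)
    (hy : ∀ r ∈ Icc a b, HasDerivAt y (m r / r) r) (hm : ∀ r ∈ Icc a b, 1 ≤ m r)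
    (hq : ∀ r ∈ Icc a b, q ≤ (m r - 1) ^ 2 + r ^ 2 * exp (-(2 * y r)))
    (hw : ∀ r ∈ Icc a b, r ^ 2 * exp (-(2 * y r)) < q) :
    log (√q + √(q - a ^ 2 * exp (-(2 * y a)))) + y a + (√q + 1) * (log b - log a)
      ≤ log (2 * √q) + y b := by
  have r0 : ∀ r ∈ Icc a b, 0 < r := fun r hr => ha.trans_le hr.1
  have q0 : 0 < q := lt_of_le_of_lt (by positivity) (hw a (left_mem_Icc.2 hab))
  set w : ℝ → ℝ := fun r => r ^ 2 * exp (-(2 * y r)) with hwdef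
  have s0 : ∀ r ∈ Icc a b, 0 < √(q - w r) := fun r hr => sqrt_pos.2 (sub_pos.2 (hw r hr))
  have a0 : 0 < √q := sqrt_pos.2 q0
  have dw : ∀ r ∈ Icc a b, HasDerivAt w (2 * w r * (1 - m r) / r) r := fun r hr => by
    have := (r0 r hr).ne'
    refine (((hasDerivAt_id r).pow 2).mul (((hy r hr).const_mul 2).neg.exp)).congr_deriv ?_
    simp [hwdef]
    field_simp
    ring
  have dc : ∀ r ∈ Icc a b, HasDerivAt (fun r => log (√q + √(q - w r)) + y r - (√q + 1) * log r)
      (√q * ((m r - 1) / √(q - w r) - 1) / r) r := fun r hr => by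
    have h1 := (r0 r hr).ne'
    have h2 := (s0 r hr)
    have h3 := (sub_pos.2 (hw r hr)).ne'
    have h4 : √q + √(q - w r) ≠ 0 := by positivity
    refine ((((((dw r hr).const_sub q).sqrt h3).const_add (√q)).log h4).add (hy r hr)
      |>.sub ((hasDerivAt_log h1).const_mul (√q + 1))).congr_deriv ?_
    have e1 := sq_sqrt q0.le
    have e2 := sq_sqrt (sub_pos.2 (hw r hr)).le
    have e3 : w r = (√q - √(q - w r)) * (√q + √(q - w r)) := by
      have : (√q - √(q - w r)) * (√q + √(q - w r)) = √q ^ 2 - √(q - w r) ^ 2 := by ring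
      rw [this, e1, e2]; ring
    generalize √(q - w r) = s at *
    generalize √q = t at *
    rw [e3]
    field_simp
    ring
  have key := le_of_hasDerivAt_nonneg hab dc fun r hr => by
    have h1 := r0 r hr
    have h2 := s0 r hr
    have h3 : √(q - w r) ≤ m r - 1 := sqrt_le_iff.2 ⟨by linarith [hm r hr], by
      have := hq r hr
      simp only [hwdef]
      linarith⟩
    have h4 : 0 ≤ (m r - 1) / √(q - w r) - 1 := by
      rw [sub_nonneg, le_div_iff₀ h2]; linarith
    positivity
  have hb : b ∈ Icc a b := right_mem_Icc.2 hab
  have sb := s0 b hb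
  have : log (√q + √(q - w b)) ≤ log (2 * √q) := by
    apply log_le_log (by positivity)
    have : √(q - w b) ≤ √q := sqrt_le_sqrt (sub_le_self _ (by positivity))
    linarith
  change log (√q + √(q - w a)) + y a + _ ≤ _
  linarith

/-- Lower bound of the mean of the source. -/
lemma le_cavg_source {L Fm : ℝ} (hL : 0 < L) {F v : ℝ → ℝ} (hv : Continuous v)
    (hF : Continuous F) (hvL : ∀ θ, -L < v θ) (hFm : 0 ≤ Fm) (hFF : ∀ θ, Fm ≤ F θ) :
    Fm * ((1 - -cavg v / L) * exp ((-cavg v) ^ 2 / L)) * exp (2 * cavg v)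
      ≤ cavg (fun θ => F θ * nl L⁻¹ (v θ)) := by
  have h0 : ∀ θ, 0 ≤ 1 + L⁻¹ * v θ := fun θ => by
    have : 1 + L⁻¹ * v θ = L⁻¹ * (v θ - -L) := by field_simp; ring
    rw [this]
    have := hvL θ
    exact mul_nonneg (by positivity) (by linarith)
  have cn := continuous_nl L⁻¹
  calc _ = Fm * nl L⁻¹ (cavg v) := by
        unfold nl
        rw [exp_add, show (-cavg v) ^ 2 / L = L⁻¹ * cavg v ^ 2 by ring]
        ring
    _ ≤ Fm * cavg (fun θ => nl L⁻¹ (v θ)) := by gcongr; exact nl_cavg_le (by positivity) hv h0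
    _ = cavg (fun θ => Fm * nl L⁻¹ (v θ)) := (cavg_const_mul _ _).symm
    _ ≤ _ := cavg_mono (by fun_prop) (by fun_prop) fun θ => by
        have : 0 ≤ nl L⁻¹ (v θ) := mul_nonneg (h0 θ) (exp_pos _).le
        exact mul_le_mul_of_nonneg_right (hFF θ) this

lemma sqrt_one_add_ge {k : ℝ} (h0 : 0 ≤ k) (h1 : k ≤ 1 / 10) : 1 + 2 / 5 * k ≤ √(1 + k) := by
  apply le_sqrt_of_sq_le
  nlinarith

/-- The exit contradiction for the mean profile outside the bubble. -/
lemma mean_profile_false {L S : ℝ} (hL : 100 ≤ L) (hS : S = 2 * exp (L / 2)) {y m g : ℝ → ℝ}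
    (hy : ∀ r ∈ Ico 8 S, HasDerivAt y (m r / r) r)
    (hm : ∀ r ∈ Ico 8 S, HasDerivAt m (r * g r) r)
    (hg : ∀ r ∈ Ico 8 S, 0 ≤ g r)
    (hgy : ∀ r ∈ Ico 8 S, 2 ≤ y r → 3 / 2 * log r - 1 / 2 ≤ y r → y r ≤ L - 1 / 25 →
      exp (-(2 * y r)) ≤ g r)
    (hyL : ∀ r ∈ Ico 8 S, y r ≤ L)
    (hm8 : 3 / 2 ≤ m 8) (hy8 : |y 8 - log 17| ≤ 1 / 10000)
    (hq8 : 1 + 1 / L ≤ (m 8 - 1) ^ 2 + 8 ^ 2 * exp (-(2 * y 8))) : False := by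
  have mL : ∀ r ∈ Ico 8 S, 3 / 2 ≤ m r := fun r hr =>
    hm8.trans (le_of_hasDerivAt_nonneg hr.1
      (fun t ht => hm t ⟨ht.1, ht.2.trans_lt hr.2⟩)
      (fun t ht => mul_nonneg (by linarith [ht.1]) (hg t ⟨ht.1, ht.2.trans_lt hr.2⟩)))
  have yg : ∀ a b, 8 ≤ a → a ≤ b → b < S → y a + 3 / 2 * (log b - log a) ≤ y b := by
    intro a b ha hab hb
    have mem : ∀ t ∈ Icc a b, t ∈ Ico 8 S := fun t ht => ⟨ha.trans ht.1, ht.2.trans_lt hb⟩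
    have := le_of_hasDerivAt_nonneg hab (f := fun r => y r - 3 / 2 * log r)
      (fun t ht => (hy t (mem t ht)).sub ((hasDerivAt_log (by linarith [ht.1])).const_mul (3 / 2)))
      (fun t ht => by
        have h1 := mL t (mem t ht)
        have h2 : 0 < t := by linarith [ht.1]
        rw [← div_eq_mul_inv, ← sub_div]
        exact div_nonneg (by linarith) h2.le)
    linarith
  have l2 := log_two_gt_d9
  have l2' := log_two_lt_d9
  have l8 : log 8 = 3 * log 2 := by
    rw [show (8 : ℝ) = 2 ^ 3 by norm_num, log_pow]; norm_num
  have l17 : 4 * log 2 ≤ log 17 := by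
    rw [show 4 * log 2 = log 16 by rw [show (16 : ℝ) = 2 ^ 4 by norm_num, log_pow]; norm_num]
    exact log_le_log (by norm_num) (by norm_num)
  have hy8' := abs_le.1 hy8
  set r1 : ℝ := 2 * exp (L / 2 - 1 / 20) with hr1
  set r2 : ℝ := 2 * exp (L / 2 - 1 / 200) with hr2
  have lr1 : log r1 = log 2 + (L / 2 - 1 / 20) := by
    rw [hr1, log_mul (by norm_num) (exp_pos _).ne', log_exp]
  have lr2 : log r2 = log 2 + (L / 2 - 1 / 200) := by
    rw [hr2, log_mul (by norm_num) (exp_pos _).ne', log_exp]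
  have r12 : r1 ≤ r2 := by rw [hr1, hr2]; gcongr; norm_num
  have r2S : r2 < S := by rw [hS, hr2]; gcongr; linarith
  have r18 : 8 ≤ r1 := by
    have := add_one_le_exp (L / 2 - 1 / 20)
    rw [hr1]; linarith
  have m8 : (8 : ℝ) ∈ Ico 8 S := ⟨le_rfl, by linarith⟩
  have hr1y : L - 1 / 25 < y r1 := by
    by_contra! hc
    have mem : ∀ t ∈ Icc 8 r1, t ∈ Ico 8 S := fun t ht => ⟨ht.1, by linarith [ht.2]⟩
    have gy : ∀ t ∈ Icc 8 r1, exp (-(2 * y t)) ≤ g t := fun t ht => by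
      have h1 := yg 8 t le_rfl ht.1 (mem t ht).2
      have h2 := yg t r1 ht.1 ht.2 (by linarith)
      have h3 := log_le_log (by norm_num) ht.1
      have h4 := log_le_log (by linarith [ht.1]) ht.2
      exact hgy t (mem t ht) (by linarith) (by linarith) (by linarith)
    have hq : ∀ t ∈ Icc 8 r1, 1 + 1 / L ≤ (m t - 1) ^ 2 + t ^ 2 * exp (-(2 * y t)) :=
      fun t ht => by
      refine hq8.trans (le_of_hasDerivAt_nonneg ht.1
        (f := fun t => (m t - 1) ^ 2 + t ^ 2 * exp (-(2 * y t)))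
        (f' := fun t => 2 * (m t - 1) * t * (g t - exp (-(2 * y t)))) (fun s hs => ?_)
        fun s hs => ?_)
      · have hs' := mem s ⟨hs.1, hs.2.trans ht.2⟩
        have s0 : s ≠ 0 := by linarith [hs.1]
        refine ((((hm s hs').sub_const 1).pow 2).add (((hasDerivAt_id s).pow 2).mul
          (((hy s hs').const_mul 2).neg.exp))).congr_deriv ?_
        simp
        field_simp
        ring
      · have hs' : s ∈ Icc 8 r1 := ⟨hs.1, hs.2.trans ht.2⟩
        have h1 := gy s hs'
        have h2 := mL s (mem s hs')
        have h3 := hs.1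
        exact mul_nonneg (mul_nonneg (by linarith) (by linarith)) (by linarith)
    have iL : 0 < 1 / L := by positivity
    have iL1 : 1 / L ≤ 1 / 100 := by gcongr
    have w8 : 8 ^ 2 * exp (-(2 * y 8)) ≤ 0.2216 := by
      have h1 : exp (-(2 * y 8)) ≤ exp (2 / 10000) * (exp (log 17) ^ 2)⁻¹ := by
        rw [← exp_nat_mul, ← exp_neg, ← exp_add]
        apply exp_le_exp.2
        push_cast
        linarith
      rw [exp_log (by norm_num)] at h1
      have h2 : exp (2 / 10000) ≤ 1.0003 := by
        have := add_one_le_exp (-(2 / 10000) : ℝ)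
        rw [exp_neg] at this
        have h3 : exp (2 / 10000) ≤ (-(2 / 10000) + 1)⁻¹ := by
          rw [le_inv_comm₀ (exp_pos _) (by norm_num)]
          exact this
        refine h3.trans (by norm_num)
      norm_num at h1 ⊢
      linarith
    have hw : ∀ t ∈ Icc 8 r1, t ^ 2 * exp (-(2 * y t)) < 1 + 1 / L := fun t ht => by
      have e : ∀ t : ℝ, 0 < t → t ^ 2 * exp (-(2 * y t)) = exp (2 * log t - 2 * y t) :=
        fun t ht => by
        rw [sub_eq_add_neg, exp_add, ← exp_log ht, log_exp, ← exp_nat_mul]; norm_num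
      have h1 := yg 8 t le_rfl ht.1 (mem t ht).2
      have h3 := log_le_log (by norm_num) ht.1
      have : t ^ 2 * exp (-(2 * y t)) ≤ 8 ^ 2 * exp (-(2 * y 8)) := by
        rw [e t (by linarith [ht.1]), e 8 (by norm_num)]
        apply exp_le_exp.2; linarith
      linarith
    have key := log_growth (by norm_num) r18 (fun t ht => hy t (mem t ht))
      (fun t ht => by linarith [mL t (mem t ht)]) hq hw
    have sq := sqrt_one_add_ge iL.le (by linarith)
    set a := √(1 + 1 / L) with ha
    have s1 : 0.882 ≤ √(1 + 1 / L - 8 ^ 2 * exp (-(2 * y 8))) := by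
      apply le_sqrt_of_sq_le
      linarith
    have h1 : 5 * log 2 - log 17 - 1 / 1000 ≤
        log (a + √(1 + 1 / L - 8 ^ 2 * exp (-(2 * y 8)))) := by
      have e1 : log 1.882 ≤ log (a + √(1 + 1 / L - 8 ^ 2 * exp (-(2 * y 8)))) :=
        log_le_log (by norm_num) (by linarith)
      have e2 := one_sub_inv_le_log_of_pos (x := 1.882 * 17 / 32) (by norm_num)
      rw [log_div (by norm_num) (by norm_num), log_mul (by norm_num) (by norm_num),
        show (32 : ℝ) = 2 ^ 5 by norm_num, log_pow] at e2
      push_cast at e2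
      have e3 : (-1 / 1000 : ℝ) ≤ 1 - (1.882 * 17 / 2 ^ 5)⁻¹ := by norm_num
      linarith
    have a0 : 0 < a := by linarith
    have h2 : log a ≤ 1 / 200 := by
      have e1 := log_le_sub_one_of_pos a0
      have e2 : a ≤ 1 + 1 / L / 2 := by
        apply sqrt_le_iff.2 ⟨by positivity, by nlinarith⟩
      linarith
    rw [log_mul (by norm_num) a0.ne', lr1, l8] at key
    have h3 := mul_le_mul_of_nonneg_right sq
      (by linarith : 0 ≤ log 2 + (L / 2 - 1 / 20) - 3 * log 2)
    have h4 : (1 + 2 / 5 * (1 / L)) * (log 2 + (L / 2 - 1 / 20) - 3 * log 2)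
        = L / 2 - 1 / 20 - 2 * log 2 + 1 / 5 - 2 / 5 * (1 / L) * (1 / 20 + 2 * log 2) := by
      field_simp
      ring
    have h5 : 1 / L * (1 / 20 + 2 * log 2) ≤ 1 / 100 * 2 := by
      gcongr; linarith
    linarith
  have h2 := hyL r2 ⟨by linarith, r2S⟩
  have h3 := yg r1 r2 r18 r12 r2S
  linarith

/-- There is no solution in polar coordinates which is close to the bubble in a fixed disc and
stays above `-L` in the disc of radius `2 exp (L / 2)`. -/
lemma no_large_polarSolution (Λ : ℝ) {c0 : ℝ} (hc0 : 0 < c0) : ∃ ε > 0, ∀ᶠ L in atTop,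
    ∀ F V Vr Vrr Vt Vtt : ℝ → ℝ → ℝ,
    PolarSolution (2 * exp (L / 2)) V Vr Vrr Vt Vtt (fun r θ => F r θ * nl L⁻¹ (V r θ)) →
    (∀ r ∈ Ico 0 (2 * exp (L / 2)), Continuous (F r)) →
    (∀ r ∈ Ico 0 (2 * exp (L / 2)), ∀ θ, |F r θ - 1| ≤ |Λ| * r * exp (-(L / 2))) →
    (∀ r ∈ Ico 0 (2 * exp (L / 2)), ∀ θ, c0 ≤ F r θ) →
    (∀ r ∈ Ico 0 (2 * exp (L / 2)), ∀ θ, -L < V r θ) →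
    (∀ r ∈ Icc (0 : ℝ) 8, ∀ θ, |V r θ - bub r| ≤ ε) → False := by
  obtain ⟨ε, ε0, -, H⟩ := pohozaev_gain
  refine ⟨ε, ε0, ?_⟩
  filter_upwards [eventually_ge_atTop 100, eventually_ge_atTop (1 / ε),
    eventually_one_le_factor Λ hc0,
    eventually_mul_exp_neg_le (8 * |Λ|) (a := 1 / 2) (b := ε) (by norm_num) ε0]
    with L hL hLε hfac hν F V Vr Vrr Vt Vtt h hF hF1 hFc hVL hV
  have L0 : 0 < L := by linarith
  have hexp := add_one_le_exp (L / 2)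
  set S := 2 * exp (L / 2) with hS
  have S8 : 8 < S := by rw [hS]; linarith
  have sub : ∀ r ∈ Icc (0 : ℝ) 8, r ∈ Ico 0 S := fun r hr => ⟨hr.1, by linarith [hr.2]⟩
  have sub' : ∀ r ∈ Ico 8 S, r ∈ Ico 0 S := fun r hr => ⟨by linarith [hr.1], hr.2⟩
  have mem : ∀ r ∈ Ico 0 S, r ∈ Ioo (-S) S := fun r hr => ⟨by linarith [hr.1], hr.2⟩
  obtain ⟨g1, g2, g3⟩ := H L⁻¹ (8 * |Λ| * exp (-(L / 2))) S (by positivity)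
    (by rw [inv_le_comm₀ L0 ε0, ← one_div]; exact hLε) (by positivity) (by
      rw [← div_eq_mul_inv, le_div_iff₀ L0]
      rw [show 1 / 2 * L = L / 2 by ring] at hν
      linarith) S8 F V Vr Vrr Vt Vtt h (fun r hr => hF r (sub r hr))
    (fun r hr θ => (hF1 r (sub r hr) θ).trans (by
      have := hr.2
      calc |Λ| * r * exp (-(L / 2)) ≤ |Λ| * 8 * exp (-(L / 2)) := by gcongr
        _ = _ := by ring)) hV
  have cs : ∀ r ∈ Ico 0 S, Continuous (V r) := fun r hr => continuous_slice h.cV (mem r hr)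
  have src := fun r (hr : r ∈ Ico 0 S) {Fm : ℝ} => le_cavg_source (Fm := Fm) L0 (cs r hr) (hF r hr)
    (hVL r hr)
  have hyL : ∀ r ∈ Ico 0 S, -cavg (V r) ≤ L := fun r hr => by
    have := cavg_mono continuous_const (cs r hr) fun θ => (hVL r hr θ).le
    rw [cavg_const] at this
    linarith
  refine mean_profile_false hL hS (y := fun r => -cavg (V r)) (m := fun r => -(r * cavg (Vr r)))
    (g := fun r => cavg (fun θ => F r θ * nl L⁻¹ (V r θ)))
    (fun r hr => ?_) (fun r hr => h.hasDerivAt_flux (mem r (sub' r hr))) (fun r hr => ?_)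
    (fun r hr h1 h2 h3 => ?_) (fun r hr => hyL r (sub' r hr)) g2 ?_ ?_
  · have : r ≠ 0 := by linarith [hr.1]
    refine (h.hasDerivAt_mean (mem r (sub' r hr))).neg.congr_deriv ?_
    field_simp
  · refine le_trans ?_ (src r (sub' r hr) le_rfl fun θ => hc0.le.trans (hFc r (sub' r hr) θ))
    simp
  · have := sub' r hr
    set Fm := max (1 - |Λ| * r * exp (-(L / 2))) c0 with hFm
    refine le_trans ?_ (src r this (Fm := Fm) (hc0.le.trans (le_max_right _ _))
      fun θ => max_le ?_ (hFc r this θ))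
    · have a := hfac r (-cavg (V r)) Fm (by linarith [hr.1]) h1 h2 h3 (le_max_left _ _)
        (le_max_right _ _)
      rw [show -(2 * -cavg (V r)) = 2 * cavg (V r) by ring]
      exact le_mul_of_one_le_left (exp_pos _).le a
    · linarith [(abs_le.1 (hF1 r this θ)).1]
  · rw [show -cavg (V 8) - log 17 = -(cavg (V 8) + log 17) by ring, abs_neg]
    exact g3
  · unfold pohozaev at g1
    rw [one_div, show -(2 * -cavg (V 8)) = 2 * cavg (V 8) by ring]
    convert g1 using 2
    ring

/-- The unit vector of angle `θ`. -/
def unitVec (θ : ℝ) : Pt :=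
  cos θ • EuclideanSpace.single 0 1 + sin θ • EuclideanSpace.single 1 1

/-- The unit vector orthogonal to `unitVec θ`. -/
def unitVec' (θ : ℝ) : Pt :=
  (-sin θ) • EuclideanSpace.single 0 1 + cos θ • EuclideanSpace.single 1 1

lemma norm_unitVec (θ : ℝ) : ‖unitVec θ‖ = 1 := by
  rw [EuclideanSpace.norm_eq, Fin.sum_univ_two]
  simp [unitVec]

lemma hasDerivAt_unitVec (θ : ℝ) : HasDerivAt unitVec (unitVec' θ) θ :=
  ((hasDerivAt_cos θ).smul_const _).add ((hasDerivAt_sin θ).smul_const _)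

lemma hasDerivAt_unitVec' (θ : ℝ) : HasDerivAt unitVec' (-unitVec θ) θ := by
  refine (((hasDerivAt_sin θ).neg.smul_const (EuclideanSpace.single (0 : Fin 2) (1 : ℝ))).add
    ((hasDerivAt_cos θ).smul_const (EuclideanSpace.single (1 : Fin 2) (1 : ℝ)))).congr_deriv ?_
  rw [unitVec, neg_add, neg_smul, neg_smul]

lemma continuous_unitVec : Continuous unitVec := by unfold unitVec; fun_prop

lemma continuous_unitVec' : Continuous unitVec' := by unfold unitVec'; fun_prop

/-- The second derivatives along an orthonormal frame sum up to minus the Laplacian. -/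
lemma hessian_unitVec {u : Pt → ℝ} {x : Pt} (hu : DifferentiableAt ℝ (fderiv ℝ u) x) (θ : ℝ) :
    fderiv ℝ (fderiv ℝ u) x (unitVec θ) (unitVec θ)
      + fderiv ℝ (fderiv ℝ u) x (unitVec' θ) (unitVec' θ) = -lap u x := by
  have h : ∀ v : Pt, fderiv ℝ (fun y => fderiv ℝ u y v) x v = fderiv ℝ (fderiv ℝ u) x v v :=
    fun v => by
    rw [fderiv_clm_apply hu (differentiableAt_const v)]
    simp
  simp only [lap, Fin.sum_univ_two, h, unitVec, unitVec']
  generalize fderiv ℝ (fderiv ℝ u) x = B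
  simp only [map_add, map_smul, add_apply, smul_apply,
    smul_eq_mul]
  linear_combination (B (EuclideanSpace.single 0 1) (EuclideanSpace.single 0 1)
    + B (EuclideanSpace.single 1 1) (EuclideanSpace.single 1 1)) * sin_sq_add_cos_sq θ

/-- The point of polar coordinates `(μ r, θ)` around `x₀`. -/
def polarPt (x₀ : Pt) (μ r θ : ℝ) : Pt := x₀ + (μ * r) • unitVec θ

lemma polarPt_mem {x₀ : Pt} {μ S r θ : ℝ} (hμ : 0 < μ) (hr : r ∈ Ioo (-S) S) :
    polarPt x₀ μ r θ ∈ ball x₀ (μ * S) := by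
  rw [mem_ball, dist_eq_norm, polarPt, add_sub_cancel_left, norm_smul, norm_unitVec, mul_one,
    Real.norm_eq_abs, abs_mul, abs_of_pos hμ]
  exact mul_lt_mul_of_pos_left (abs_lt.2 hr) hμ

lemma continuous_polarPt (x₀ : Pt) (μ : ℝ) : Continuous (Function.uncurry (polarPt x₀ μ)) := by
  have := continuous_unitVec
  unfold polarPt Function.uncurry
  fun_prop

lemma continuousOn_polarPt {E : Type*} [TopologicalSpace E] {g : Pt → E} {x₀ : Pt} {μ S : ℝ}
    (hμ : 0 < μ) (hg : ContinuousOn g (ball x₀ (μ * S))) :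
    ContinuousOn (fun p : ℝ × ℝ => g (polarPt x₀ μ p.1 p.2)) (Ioo (-S) S ×ˢ univ) :=
  hg.comp (continuous_polarPt x₀ μ).continuousOn fun _ hp => polarPt_mem hμ hp.1

lemma hasDerivAt_polarPt_left (x₀ : Pt) (μ r θ : ℝ) :
    HasDerivAt (fun r => polarPt x₀ μ r θ) (μ • unitVec θ) r := by
  have := (((hasDerivAt_id r).const_mul μ).smul_const (unitVec θ)).const_add x₀
  simpa [polarPt] using this

lemma hasDerivAt_polarPt_right (x₀ : Pt) (μ r θ : ℝ) :
    HasDerivAt (polarPt x₀ μ r) ((μ * r) • unitVec' θ) θ :=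
  ((hasDerivAt_unitVec θ).const_smul (μ * r)).const_add x₀

/-- A rescaled solution, in polar coordinates around a critical point. -/
lemma polarSolution_of_lap_eq {u g : Pt → ℝ} {x₀ : Pt} {μ γ S : ℝ} (hμ : 0 < μ)
    (hu : ∀ x ∈ ball x₀ (μ * S), ContDiffAt ℝ 2 u x)
    (hg : ContinuousOn g (ball x₀ (μ * S))) (heq : ∀ x ∈ ball x₀ (μ * S), lap u x = g x)
    (hcrit : fderiv ℝ u x₀ = 0) (hγ : γ = u x₀) :
    PolarSolution S (fun r θ => γ * (u (polarPt x₀ μ r θ) - γ))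
      (fun r θ => γ * (μ * fderiv ℝ u (polarPt x₀ μ r θ) (unitVec θ)))
      (fun r θ => γ * (μ ^ 2 *
        fderiv ℝ (fderiv ℝ u) (polarPt x₀ μ r θ) (unitVec θ) (unitVec θ)))
      (fun r θ => γ * (μ * r * fderiv ℝ u (polarPt x₀ μ r θ) (unitVec' θ)))
      (fun r θ => γ * (μ * r * (μ * r *
        fderiv ℝ (fderiv ℝ u) (polarPt x₀ μ r θ) (unitVec' θ) (unitVec' θ)
          - fderiv ℝ u (polarPt x₀ μ r θ) (unitVec θ))))
      (fun r θ => γ * (μ ^ 2 * g (polarPt x₀ μ r θ))) := by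
  have hA : ∀ x ∈ ball x₀ (μ * S), HasFDerivAt u (fderiv ℝ u x) x := fun x hx =>
    ((hu x hx).differentiableAt (by norm_num)).hasFDerivAt
  have hA1 : ∀ x ∈ ball x₀ (μ * S), ContDiffAt ℝ 1 (fderiv ℝ u) x := fun x hx =>
    (hu x hx).fderiv_right (by norm_num)
  have hB : ∀ x ∈ ball x₀ (μ * S),
      HasFDerivAt (fderiv ℝ u) (fderiv ℝ (fderiv ℝ u) x) x := fun x hx =>
    ((hA1 x hx).differentiableAt (by norm_num)).hasFDerivAt
  have cu : ContinuousOn u (ball x₀ (μ * S)) := fun x hx =>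
    (hA x hx).continuousAt.continuousWithinAt
  have cA : ContinuousOn (fderiv ℝ u) (ball x₀ (μ * S)) := fun x hx =>
    (hB x hx).continuousAt.continuousWithinAt
  have cB : ContinuousOn (fderiv ℝ (fderiv ℝ u)) (ball x₀ (μ * S)) := fun x hx =>
    ((hA1 x hx).fderiv_right (m := 0) (by norm_num)).continuousAt.continuousWithinAt
  have pu := continuousOn_polarPt hμ cu
  have pA := continuousOn_polarPt hμ cA
  have pB := continuousOn_polarPt hμ cB
  have pg := continuousOn_polarPt hμ hg
  have ce : ContinuousOn (fun p : ℝ × ℝ => unitVec p.2) (Ioo (-S) S ×ˢ univ) :=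
    (continuous_unitVec.comp continuous_snd).continuousOn
  have ce' : ContinuousOn (fun p : ℝ × ℝ => unitVec' p.2) (Ioo (-S) S ×ˢ univ) :=
    (continuous_unitVec'.comp continuous_snd).continuousOn
  have p0 : ∀ θ, polarPt x₀ μ 0 θ = x₀ := fun θ => by simp [polarPt]
  refine ⟨fun r hr θ => ?_, fun r hr θ => ?_, fun r hr θ => ?_, fun r hr θ => ?_,
    ?_, ?_, ?_, ?_, ?_, ?_, fun r hr => ?_, fun r hr => ?_, fun r hr θ => ?_, fun θ => ?_,
    fun θ => ?_⟩
  · have := (hA _ (polarPt_mem (θ := θ) hμ hr)).comp_hasDerivAt r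
      (hasDerivAt_polarPt_left x₀ μ r θ)
    refine ((this.sub_const γ).const_mul γ).congr_deriv ?_
    simp
  · have := (hB _ (polarPt_mem (θ := θ) hμ hr)).comp_hasDerivAt r
      (hasDerivAt_polarPt_left x₀ μ r θ)
    refine (((this.clm_apply (hasDerivAt_const r (unitVec θ))).const_mul μ).const_mul
      γ).congr_deriv ?_
    simp only [map_smul, smul_apply, smul_eq_mul, map_zero, add_zero]
    ring
  · have := (hA _ (polarPt_mem (θ := θ) hμ hr)).comp_hasDerivAt θ
      (hasDerivAt_polarPt_right x₀ μ r θ)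
    refine ((this.sub_const γ).const_mul γ).congr_deriv ?_
    simp
  · have := (hB _ (polarPt_mem (θ := θ) hμ hr)).comp_hasDerivAt θ
      (hasDerivAt_polarPt_right x₀ μ r θ)
    refine (((this.clm_apply (hasDerivAt_unitVec' θ)).const_mul (μ * r)).const_mul
      γ).congr_deriv ?_
    simp only [map_smul, smul_apply, smul_eq_mul, map_neg, Function.comp]
    ring
  · exact continuousOn_const.mul (pu.sub continuousOn_const)
  · exact continuousOn_const.mul (continuousOn_const.mul (pA.clm_apply ce))
  · exact continuousOn_const.mul (continuousOn_const.mul ((pB.clm_apply ce).clm_apply ce))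
  · exact continuousOn_const.mul ((continuousOn_const.mul continuousOn_fst).mul (pA.clm_apply ce'))
  · exact continuousOn_const.mul ((continuousOn_const.mul continuousOn_fst).mul
      (((continuousOn_const.mul continuousOn_fst).mul ((pB.clm_apply ce').clm_apply ce')).sub
        (pA.clm_apply ce)))
  · exact continuousOn_const.mul (continuousOn_const.mul pg)
  · simp [polarPt, unitVec]
  · simp [polarPt, unitVec, unitVec']
  · have hx := polarPt_mem (x₀ := x₀) (θ := θ) hμ hr
    have := hessian_unitVec (hB _ hx).differentiableAt θ
    rw [heq _ hx] at this
    linear_combination (γ * (μ * r) ^ 2) * this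
  · simp [p0, hγ]
  · simp [p0, hcrit]

/-- A function which is `C¹` up to the boundary of a bounded open set has bounded gradient. -/
lemma exists_norm_fderiv_le {Ω : Set Pt} (hΩo : IsOpen Ω) (hΩb : Bornology.IsBounded Ω)
    {f : Pt → ℝ} (hf : ContDiffOn ℝ 1 f (closure Ω)) : ∃ K, ∀ x ∈ Ω, ‖fderiv ℝ f x‖ ≤ K := by
  suffices H : ∃ K, ∀ x ∈ closure Ω ∩ Ω, ‖fderiv ℝ f x‖ ≤ K by
    obtain ⟨K, hK⟩ := H
    exact ⟨K, fun x hx => hK x ⟨subset_closure hx, hx⟩⟩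
  refine hΩb.isCompact_closure.induction_on (p := fun s => ∃ K, ∀ x ∈ s ∩ Ω, ‖fderiv ℝ f x‖ ≤ K)
    ⟨0, by simp⟩ ?_ ?_ ?_
  · rintro s t hst ⟨K, hK⟩
    exact ⟨K, fun x hx => hK x ⟨hst hx.1, hx.2⟩⟩
  · rintro s t ⟨K, hK⟩ ⟨K', hK'⟩
    refine ⟨max K K', fun x hx => ?_⟩
    rcases hx.1 with h | h
    · exact (hK x ⟨h, hx.2⟩).trans (le_max_left _ _)
    · exact (hK' x ⟨h, hx.2⟩).trans (le_max_right _ _)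
  · intro x hx
    have h1 : ContDiffWithinAt ℝ (0 + 1) f (closure Ω) x := by simpa using hf x hx
    obtain ⟨v, hv, -, -, f', hf', cf'⟩ :=
      (contDiffWithinAt_succ_iff_hasFDerivWithinAt' (by simp)).1 h1
    rw [insert_eq_of_mem hx] at hv
    have h2 := cf'.continuousWithinAt.norm.eventually (gt_mem_nhds (lt_add_one _))
    refine ⟨_, inter_mem hv h2, ‖f' x‖ + 1, fun y hy => ?_⟩
    have := (hf' y hy.1.1).hasFDerivAt
      (mem_of_superset (hΩo.mem_nhds hy.2) subset_closure)
    rw [this.fderiv]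
    exact le_of_lt hy.1.2

lemma dist_iteratedFDeriv_zero (f g : Pt → ℝ) (x : Pt) :
    dist (iteratedFDeriv ℝ 0 f x) (iteratedFDeriv ℝ 0 g x) = |f x - g x| := by
  rw [iteratedFDeriv_zero_eq_comp, iteratedFDeriv_zero_eq_comp, Function.comp, Function.comp,
    LinearIsometryEquiv.dist_map, Real.dist_eq]

lemma ball_infDist_frontier_subset {Ω : Set Pt} (hΩo : IsOpen Ω) {x : Pt} (hx : x ∈ Ω) :
    ball x (infDist x (frontier Ω)) ⊆ Ω := by
  intro y hy
  have hd : 0 < infDist x (frontier Ω) := pos_of_mem_ball hy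
  refine (convex_ball x (infDist x (frontier Ω))).isPreconnected.subset_left_of_subset_union hΩo
    isClosed_closure.isOpen_compl (disjoint_compl_right.mono_left subset_closure) (fun z hz => ?_)
    ⟨x, mem_ball_self hd, hx⟩ hy
  by_contra! h
  simp only [mem_union, mem_compl_iff, not_or, not_not] at h
  have hzf : z ∈ frontier Ω := hΩo.frontier_eq ▸ ⟨h.2, h.1⟩
  have := infDist_le_dist_of_mem (x := x) hzf
  rw [dist_comm] at this
  exact absurd (mem_ball.1 hz) this.not_gt

/-- Uniform bounds for the weights. -/
lemma eventually_weight_bounds {Ω : Set Pt} (hΩo : IsOpen Ω) (hΩb : Bornology.IsBounded Ω)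
    (hΩne : Ω.Nonempty) {f : ℕ → Pt → ℝ} {f₀ : Pt → ℝ} (hf₀ : ContDiffOn ℝ 1 f₀ (closure Ω))
    (hf₀pos : ∀ x ∈ closure Ω, 0 < f₀ x) (hfc : TendstoCkOn f f₀ (closure Ω) 1) :
    ∃ c > 0, ∃ M K, ∀ᶠ n in atTop, ∀ x ∈ Ω, c ≤ f n x ∧ f n x ≤ M ∧ ‖fderiv ℝ (f n) x‖ ≤ K := by
  have hc : IsCompact (closure Ω) := hΩb.isCompact_closure
  obtain ⟨a, ha, hamin⟩ := hc.exists_isMinOn hΩne.closure hf₀.continuousOn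
  obtain ⟨b, hb, hbmax⟩ := hc.exists_isMaxOn hΩne.closure hf₀.continuousOn
  obtain ⟨K, hK⟩ := exists_norm_fderiv_le hΩo hΩb hf₀
  have a0 := hf₀pos a ha
  refine ⟨f₀ a / 2, by positivity, f₀ b + f₀ a / 2, K + 1, ?_⟩
  filter_upwards [Metric.tendstoUniformlyOn_iff.1 (hfc 0 (by norm_num)) (f₀ a / 2) (by positivity),
    Metric.tendstoUniformlyOn_iff.1 (hfc 1 le_rfl) 1 one_pos] with n h0 h1 x hx
  have hx' := subset_closure hx
  have e0 := h0 x hx'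
  rw [dist_iteratedFDeriv_zero, abs_lt] at e0
  have e1 : f₀ a ≤ f₀ x := hamin hx'
  have e2 : f₀ x ≤ f₀ b := hbmax hx'
  refine ⟨by linarith, by linarith, ?_⟩
  rw [← norm_iteratedFDeriv_one]
  have e3 := h1 x hx'
  rw [dist_comm, dist_eq_norm] at e3
  have e4 := norm_sub_norm_le (iteratedFDeriv ℝ 1 (f n) x) (iteratedFDeriv ℝ 1 f₀ x)
  have e5 := hK x hx
  rw [← norm_iteratedFDeriv_one] at e5
  linarith

lemma eventually_scale_le {Ω : Set Pt} (hΩb : Bornology.IsBounded Ω) : ∃ D, ∀ x ∈ Ω,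
    infDist x (frontier Ω) ≤ D := by
  rcases (frontier Ω).eq_empty_or_nonempty with h | ⟨z, hz⟩
  · exact ⟨0, fun x _ => by simp [h]⟩
  · refine ⟨diam (closure Ω), fun x hx => (infDist_le_dist_of_mem hz).trans ?_⟩
    exact dist_le_diam_of_mem hΩb.closure (subset_closure hx) (frontier_subset_closure hz)

/-- The rescaled equation near a concentration point. -/
lemma rescaled_source_eq {lam a b t γ μ V : ℝ} (hγ : γ ≠ 0) (hb : b ≠ 0)
    (hμ : μ ^ 2 * (lam * b * γ ^ 2 * exp (γ ^ 2)) = 1) (hV : V = γ * (t - γ)) :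
    γ * (μ ^ 2 * (lam * a * t * exp (t ^ 2))) = a / b * nl (γ ^ 2)⁻¹ V := by
  have ht : t = γ + V / γ := by rw [hV]; field_simp; ring
  have e : t ^ 2 = γ ^ 2 + (2 * V + (γ ^ 2)⁻¹ * V ^ 2) := by
    rw [ht]; field_simp; ring
  have e2 : γ * t = γ ^ 2 * (1 + (γ ^ 2)⁻¹ * V) := by rw [ht]; field_simp
  unfold nl
  rw [e, exp_add]
  generalize exp (2 * V + (γ ^ 2)⁻¹ * V ^ 2) = E
  calc _ = μ ^ 2 * lam * a * (γ * t) * exp (γ ^ 2) * E := by ring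
    _ = a / b * (μ ^ 2 * (lam * b * γ ^ 2 * exp (γ ^ 2))) * (1 + (γ ^ 2)⁻¹ * V) * E := by
      rw [e2]; field_simp
    _ = _ := by rw [hμ]; ring

lemma two_mul_scale_lt {lam b γ μ d : ℝ} (hμ0 : 0 < μ) (hd : 0 ≤ d)
    (hμ : μ ^ 2 * (lam * b * γ ^ 2 * exp (γ ^ 2)) = 1) (h : 4 < lam * b * γ ^ 2 * d ^ 2) :
    μ * (2 * exp (γ ^ 2 / 2)) < d := by
  apply lt_of_pow_lt_pow_left₀ 2 hd
  have e : exp (γ ^ 2) = exp (γ ^ 2 / 2) ^ 2 := by rw [← exp_nat_mul]; congr 1; push_cast; ring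
  have h1 := mul_lt_mul_of_pos_left h (by positivity : 0 < μ ^ 2 * exp (γ ^ 2))
  calc _ = μ ^ 2 * exp (γ ^ 2) * 4 := by rw [e]; ring
    _ < _ := h1
    _ = μ ^ 2 * (lam * b * γ ^ 2 * exp (γ ^ 2)) * d ^ 2 := by ring
    _ = d ^ 2 := by rw [hμ, one_mul]

theorem stmt10
    (Ω : Set Pt) (hΩo : IsOpen Ω) (hΩb : Bornology.IsBounded Ω) (hΩne : Ω.Nonempty)
    (lam : ℕ → ℝ) (hlam : ∀ n, 0 < lam n)
    (f : ℕ → Pt → ℝ) (f₀ : Pt → ℝ)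
    (hfs : ∀ n, ContDiffOn ℝ (⊤ : ℕ∞) (f n) (closure Ω))
    (hf₀s : ContDiffOn ℝ (⊤ : ℕ∞) f₀ (closure Ω))
    (hf₀pos : ∀ x ∈ closure Ω, 0 < f₀ x)
    (hfc : TendstoCkOn f f₀ (closure Ω) 1)
    (hf2 : ∃ K : ℝ, ∀ n, ∀ x ∈ Ω, ‖iteratedFDeriv ℝ 2 (f n) x‖ ≤ K)
    (u : ℕ → Pt → ℝ)
    (hus : ∀ n, ContDiffOn ℝ (⊤ : ℕ∞) (u n) (closure Ω))
    (hup : ∀ n, ∀ x ∈ Ω, 0 < u n x)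
    (hueq : ∀ n, ∀ x ∈ Ω, lap (u n) x = lam n * f n x * u n x * Real.exp ((u n x) ^ 2))
    (hubd : ∀ n, ∀ x ∈ frontier Ω, u n x = 0)
    (C : ℝ) (hC : ∀ n, (∫ x in Ω, ‖gradient (u n) x‖ ^ 2) ≤ C)
    (N : ℕ) (hN : 1 ≤ N)
    (xc : Fin N → ℕ → Pt) (hxc : ∀ i n, xc i n ∈ Ω)
    (γ : Fin N → ℕ → ℝ) (hγdef : ∀ i n, γ i n = u n (xc i n))
    (hγ : ∀ i, Tendsto (γ i) atTop atTop)
    (hcrit : ∀ i n, gradient (u n) (xc i n) = 0)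
    (μ : Fin N → ℕ → ℝ) (hμpos : ∀ i n, 0 < μ i n)
    (hμdef : ∀ i n,
      (μ i n) ^ 2 * (lam n * f n (xc i n) * (γ i n) ^ 2 * Real.exp ((γ i n) ^ 2)) = 1)
    (hμinf : ∀ i, Tendsto (fun n => ((μ i n) ^ 2)⁻¹) atTop atTop)
    (hsep : ∀ i j, i ≠ j → Tendsto (fun n => ‖xc i n - xc j n‖ / μ i n) atTop atTop)
    (hconv : ∀ i, TendstoCkLocOn
      (fun n x => γ i n * (u n (xc i n + μ i n • x) - γ i n)) Ustd Set.univ 2)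
    (C₁ : ℝ) (hC₁ : ∀ n, ∀ x ∈ Ω,
      lam n * (⨅ i, ‖xc i n - x‖) ^ 2 * (u n x) ^ 2 * Real.exp ((u n x) ^ 2) ≤ C₁)
    (C₂ : ℝ) (hC₂ : ∀ n, ∀ x ∈ Ω,
      (⨅ i, ‖xc i n - x‖) * u n x * ‖gradient (u n) x‖ ≤ C₂)
    :
    ∀ i : Fin N, ∀ᶠ n in atTop,
      lam n * f n (xc i n) * (γ i n) ^ 2 * (Metric.infDist (xc i n) (frontier Ω)) ^ 2 ≤ 4 := by
  intro i
  obtain ⟨c, c0, M, K, hfb⟩ := eventually_weight_bounds hΩo hΩb hΩne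
    (hf₀s.of_le ENat.LEInfty.out) hf₀pos hfc
  obtain ⟨D, hD⟩ := eventually_scale_le hΩb
  have M0 : 0 < M := by
    obtain ⟨n, hn⟩ := hfb.exists
    have := hn _ (hxc i n)
    linarith
  obtain ⟨ε, ε0, hcore⟩ := no_large_polarSolution (K * D / c) (c0 := c / M) (by positivity)
  have hγ2 : Tendsto (fun n => γ i n ^ 2) atTop atTop :=
    (tendsto_pow_atTop two_ne_zero).comp (hγ i)
  have hbub : ∀ᶠ n in atTop, ∀ x ∈ closedBall (0 : Pt) 8,
      |γ i n * (u n (xc i n + μ i n • x) - γ i n) - Ustd x| < ε := by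
    have h := (hconv i 0 (by norm_num)).mono (subset_univ (closedBall (0 : Pt) 8))
    rw [tendstoLocallyUniformlyOn_iff_tendstoUniformlyOn_of_compact
      (isCompact_closedBall _ _)] at h
    filter_upwards [Metric.tendstoUniformlyOn_iff.1 h ε ε0] with n hn x hx
    have := hn x hx
    rwa [dist_iteratedFDeriv_zero, abs_sub_comm] at this
  filter_upwards [hfb, hbub, hγ2.eventually hcore, (hγ i).eventually (eventually_gt_atTop 0)]
    with n hfn hbn hcn hγn
  by_contra! hcon
  set d := infDist (xc i n) (frontier Ω) with hd
  set x₀ := xc i n with hx₀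
  have hx₀Ω : x₀ ∈ Ω := hxc i n
  have hμ := hμpos i n
  have hdS := two_mul_scale_lt hμ infDist_nonneg (hμdef i n) hcon
  set L := γ i n ^ 2 with hL
  set S := 2 * exp (L / 2) with hS
  have S0 : 0 < S := by positivity
  have hball : ball x₀ (μ i n * S) ⊆ Ω :=
    (ball_subset_ball hdS.le).trans (ball_infDist_frontier_subset hΩo hx₀Ω)
  have hmem : ∀ r ∈ Ico 0 S, ∀ θ, polarPt x₀ (μ i n) r θ ∈ ball x₀ (μ i n * S) :=
    fun r hr θ => polarPt_mem hμ ⟨by linarith [hr.1], hr.2⟩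
  have hfx := hfn x₀ hx₀Ω
  have hfx0 : 0 < f n x₀ := c0.trans_le hfx.1
  have hcl : ∀ x ∈ Ω, closure Ω ∈ 𝓝 x := fun x hx =>
    mem_of_superset (hΩo.mem_nhds hx) subset_closure
  have cf : ContinuousOn (f n) Ω := (hfs n).continuousOn.mono subset_closure
  have cu : ContinuousOn (u n) Ω := (hus n).continuousOn.mono subset_closure
  have hgrad : fderiv ℝ (u n) x₀ = 0 := by
    have := hcrit i n
    rwa [gradient, LinearIsometryEquiv.map_eq_zero_iff] at this
  have sol := polarSolution_of_lap_eq (S := S) hμ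
    (fun x hx => ((hus n).contDiffAt (hcl x (hball hx))).of_le ENat.LEInfty.out)
    (g := fun x => lam n * f n x * u n x * exp (u n x ^ 2))
    (((continuousOn_const.mul cf).mul cu).mul (cu.pow 2).rexp |>.mono hball)
    (fun x hx => hueq n x (hball hx)) hgrad (hγdef i n)
  have K0 : 0 ≤ K := (norm_nonneg _).trans hfx.2.2
  refine hcn (fun r θ => f n (polarPt x₀ (μ i n) r θ) / f n x₀) _ _ _ _ _
    (by
      convert sol using 3
      exact (rescaled_source_eq hγn.ne' hfx0.ne' (hμdef i n) rfl).symm)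
    (fun r hr => ?_) (fun r hr θ => ?_) (fun r hr θ => ?_) (fun r hr θ => ?_)
    (fun r hr θ => ?_)
  · refine Continuous.div_const ?_ _
    exact (cf.mono hball).comp_continuous
      ((continuous_polarPt x₀ (μ i n)).comp (Continuous.prodMk_right r)) (hmem r hr)
  · have h1 := (convex_ball x₀ (μ i n * S)).norm_image_sub_le_of_norm_fderiv_le
      (f := f n) (𝕜 := ℝ) (C := K)
      (fun x hx => ((hfs n).contDiffAt (hcl x (hball hx))).differentiableAt (by simp))
      (fun x hx => (hfn x (hball hx)).2.2) (mem_ball_self (by positivity)) (hmem r hr θ)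
    have h2 : ‖polarPt x₀ (μ i n) r θ - x₀‖ = μ i n * r := by
      rw [polarPt, add_sub_cancel_left, norm_smul, norm_unitVec, mul_one, Real.norm_eq_abs,
        abs_of_nonneg (mul_nonneg hμ.le hr.1)]
    rw [h2, Real.norm_eq_abs] at h1
    have h3 : μ i n ≤ D * exp (-(L / 2)) := by
      have := hdS.le.trans (hD x₀ hx₀Ω)
      rw [exp_neg, ← div_eq_mul_inv, le_div_iff₀ (exp_pos _)]
      have := mul_pos hμ (exp_pos (L / 2))
      rw [hS] at *
      linarith
    have r0 := hr.1
    have D0 : 0 ≤ D := infDist_nonneg.trans (hD x₀ hx₀Ω)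
    rw [div_sub_one hfx0.ne', abs_div, abs_of_pos hfx0, abs_of_nonneg (a := K * D / c)
      (div_nonneg (mul_nonneg K0 D0) c0.le)]
    calc _ ≤ K * (D * exp (-(L / 2)) * r) / c :=
          div_le_div₀ (by positivity) (h1.trans (by gcongr)) c0 hfx.1
      _ = _ := by ring
  · have := hfn _ (hball (hmem r hr θ))
    exact div_le_div₀ (c0.le.trans this.1) this.1 hfx0 hfx.2.1
  · have := mul_pos hγn (hup n _ (hball (hmem r hr θ)))
    rw [mul_sub, hL]
    linarith
  · have hn : ‖r • unitVec θ‖ = r := by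
      rw [norm_smul, norm_unitVec, mul_one, Real.norm_eq_abs, abs_of_nonneg hr.1]
    have := hbn (r • unitVec θ) (by rw [mem_closedBall_zero_iff, hn]; exact hr.2)
    rw [smul_smul, Ustd, hn] at this
    exact this.le

end
end

section
/- Let F : [0,∞) → ℝ be continuous and define φ(t) = ∫₀ᵗ e^{−s} F(s) [ (1 − 2e^{−t})(1 − 2e^{−s}) ln((eᵗ − 1)/(eˢ − 1)) + 4(e^{−s} − e^{−t}) ] ds for t ≥ 0. Then φ(0) = 0 and φ solves the linear ODE L(φ)(t) := eᵗ ((1 − e^{−t}) φ')'(t) + 2φ(t) = F(t) for all t > 0. -/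
open Set Filter Topology Real MeasureTheory

noncomputable section

lemma hasDerivAt_exp_neg (t : ℝ) : HasDerivAt (fun r => exp (-r)) (-exp (-t)) t := by
  simpa using (hasDerivAt_neg t).exp

lemma hasDerivAt_log_exp_sub_one {t : ℝ} (ht : 0 < t) :
    HasDerivAt (fun r => log (exp r - 1)) (1 - exp (-t))⁻¹ t := by
  have h1 : 0 < exp t - 1 := by linarith [one_lt_exp_iff.2 ht]
  refine (((hasDerivAt_exp t).sub_const 1).log h1.ne').congr_deriv ?_
  symm
  rw [exp_neg, inv_eq_one_div, div_eq_div_iff _ h1.ne']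
  · field_simp
  · rw [← exp_neg]
    linarith [exp_lt_one_iff.2 (neg_lt_zero.2 ht)]

lemma abs_log_exp_sub_one_le {s : ℝ} (hs : 0 < s) : |log (exp s - 1)| ≤ |log s| + s := by
  have h1 : s ≤ exp s - 1 := by linarith [add_one_le_exp s]
  have h2 : log s ≤ log (exp s - 1) := log_le_log hs h1
  have h3 : log (exp s - 1) ≤ s := by
    simpa using log_le_log (hs.trans_le h1) (show exp s - 1 ≤ exp s by linarith)
  rw [abs_le]
  constructor
  · linarith [neg_abs_le (log s)]
  · linarith [abs_nonneg (log s)]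

lemma intervalIntegrable_log_exp_sub_one {t : ℝ} (ht : 0 ≤ t) :
    IntervalIntegrable (fun s => log (exp s - 1)) volume 0 t := by
  have hg : IntervalIntegrable (fun s => |log s| + s) volume 0 t :=
    intervalIntegral.intervalIntegrable_log'.abs.add intervalIntegral.intervalIntegrable_id
  refine hg.mono_fun' (Measurable.aestronglyMeasurable (by fun_prop)) ?_
  filter_upwards [ae_restrict_mem measurableSet_uIoc] with s hs
  rw [uIoc_of_le ht] at hs
  exact abs_log_exp_sub_one_le hs.1

lemma hasDerivAt_integral_of_continuousOn_Ioi {g : ℝ → ℝ} (hg : ContinuousOn g (Ioi 0))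
    {t : ℝ} (ht : 0 < t) (hi : IntervalIntegrable g volume 0 t) :
    HasDerivAt (fun r => ∫ s in (0 : ℝ)..r, g s) (g t) t :=
  intervalIntegral.integral_hasDerivAt_right hi
    (hg.stronglyMeasurableAtFilter isOpen_Ioi t ht) (hg.continuousAt (Ioi_mem_nhds ht))

/-- **representation formula for the linearized bubble operator.**
If `φ(t) = ∫₀ᵗ e^{−s} F(s) [(1 − 2e^{−t})(1 − 2e^{−s}) ln((eᵗ−1)/(eˢ−1)) + 4(e^{−s} − e^{−t})] ds`
then `φ(0) = 0` and `L(φ)(t) = eᵗ ((1 − e^{−t}) φ')'(t) + 2 φ(t) = F(t)` for `t > 0`. -/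
theorem stmt17 (F : ℝ → ℝ) (hF : ContinuousOn F (Set.Ici 0))
    (φ : ℝ → ℝ)
    (hφ : ∀ t ≥ (0 : ℝ), φ t = ∫ s in (0 : ℝ)..t, Real.exp (-s) * F s *
      ((1 - 2 * Real.exp (-t)) * (1 - 2 * Real.exp (-s)) *
          Real.log ((Real.exp t - 1) / (Real.exp s - 1)) +
        4 * (Real.exp (-s) - Real.exp (-t)))) :
    φ 0 = 0 ∧
    ∀ t > (0 : ℝ),
      Real.exp t * deriv (fun r => (1 - Real.exp (-r)) * deriv φ r) t + 2 * φ t = F t := by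
  refine ⟨by simp [hφ 0 le_rfl], ?_⟩
  set l : ℝ → ℝ := fun s => log (exp s - 1) with hl
  set a : ℝ → ℝ := fun s => exp (-s) * F s * (1 - 2 * exp (-s)) with ha
  set b : ℝ → ℝ := fun s => exp (-s) * F s * ((1 - 2 * exp (-s)) * l s - 2) with hb
  have hlc : ContinuousOn l (Ioi 0) := fun s hs =>
    (hasDerivAt_log_exp_sub_one hs).continuousAt.continuousWithinAt
  have hac : ContinuousOn a (Ici 0) := by fun_prop
  have hbc : ContinuousOn b (Ioi 0) := by
    have := hF.mono Ioi_subset_Ici_self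
    fun_prop
  have hai : ∀ t, 0 < t → IntervalIntegrable a volume 0 t := fun t ht =>
    (hac.mono (by rw [uIcc_of_le ht.le]; exact Icc_subset_Ici_self)).intervalIntegrable
  have hbi : ∀ t, 0 < t → IntervalIntegrable b volume 0 t := fun t ht => by
    have hFt : ContinuousOn F (uIcc 0 t) :=
      hF.mono (by rw [uIcc_of_le ht.le]; exact Icc_subset_Ici_self)
    have h1 : IntervalIntegrable (fun s => a s * l s) volume 0 t :=
      (intervalIntegrable_log_exp_sub_one ht.le).continuousOn_mul
        (hac.mono (by rw [uIcc_of_le ht.le]; exact Icc_subset_Ici_self))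
    have h2 : IntervalIntegrable (fun s => exp (-s) * F s * 2) volume 0 t :=
      ContinuousOn.intervalIntegrable (by fun_prop)
    convert h1.sub h2 using 1
    funext s
    simp only [ha, hb]
    ring
  set A : ℝ → ℝ := fun t => ∫ s in (0 : ℝ)..t, a s with hA
  set B : ℝ → ℝ := fun t => ∫ s in (0 : ℝ)..t, b s with hB
  have hdA : ∀ t, 0 < t → HasDerivAt A (a t) t := fun t ht =>
    hasDerivAt_integral_of_continuousOn_Ioi (hac.mono Ioi_subset_Ici_self) ht (hai t ht)
  have hdB : ∀ t, 0 < t → HasDerivAt B (b t) t := fun t ht =>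
    hasDerivAt_integral_of_continuousOn_Ioi hbc ht (hbi t ht)
  have hrep : ∀ t, 0 < t →
      φ t = ((1 - 2 * exp (-t)) * l t - 2) * A t - (1 - 2 * exp (-t)) * B t := fun t ht => by
    rw [hφ t ht.le, hA, hB]
    simp only
    rw [← intervalIntegral.integral_const_mul, ← intervalIntegral.integral_const_mul,
      ← intervalIntegral.integral_sub ((hai t ht).const_mul _) ((hbi t ht).const_mul _)]
    refine intervalIntegral.integral_congr_ae (Eventually.of_forall fun s hs => ?_)
    rw [uIoc_of_le ht.le] at hs
    have h1 : exp t - 1 ≠ 0 := by linarith [one_lt_exp_iff.2 ht]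
    have h2 : exp s - 1 ≠ 0 := by linarith [one_lt_exp_iff.2 hs.1]
    rw [log_div h1 h2]
    simp only [ha, hb, hl]
    ring
  have hpos : ∀ t : ℝ, 0 < t → 1 - exp (-t) ≠ 0 := fun t ht => by
    linarith [exp_lt_one_iff.2 (neg_lt_zero.2 ht)]
  have hu : ∀ t, HasDerivAt (fun r => 1 - 2 * exp (-r)) (2 * exp (-t)) t := fun t => by
    refine (((hasDerivAt_exp_neg t).const_mul 2).const_sub 1).congr_deriv ?_
    ring
  have hflux : ∀ t, 0 < t → (1 - exp (-t)) * deriv φ t =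
      (2 * exp (-t) * (1 - exp (-t)) * l t + (1 - 2 * exp (-t))) * A t
        - 2 * exp (-t) * (1 - exp (-t)) * B t := fun t ht => by
    have hd := (((((hu t).mul (hasDerivAt_log_exp_sub_one ht)).sub_const 2).mul (hdA t ht)).sub
      ((hu t).mul (hdB t ht))).congr_of_eventuallyEq
        (f₁ := φ) (by filter_upwards [Ioi_mem_nhds ht] with r hr using hrep r hr)
    rw [hd.deriv]
    have := hpos t ht
    simp only [ha, hb, hl, Pi.mul_apply]
    field_simp
    ring
  intro t ht
  have hq : HasDerivAt (fun r => 2 * exp (-r) * (1 - exp (-r)))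
      (-2 * exp (-t) * (1 - 2 * exp (-t))) t := by
    refine (((hasDerivAt_exp_neg t).const_mul 2).mul
      ((hasDerivAt_exp_neg t).const_sub 1)).congr_deriv ?_
    ring
  have hd := ((((hq.mul (hasDerivAt_log_exp_sub_one ht)).add (hu t)).mul (hdA t ht)).sub
      (hq.mul (hdB t ht))).congr_of_eventuallyEq
        (f₁ := fun r => (1 - exp (-r)) * deriv φ r)
        (by filter_upwards [Ioi_mem_nhds ht] with r hr using hflux r hr)
  rw [hd.deriv, hrep t ht]
  have hE : exp t = (exp (-t))⁻¹ := by rw [exp_neg, inv_inv]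
  have hE0 := (exp_pos (-t)).ne'
  have := hpos t ht
  simp only [ha, hb, Pi.mul_apply, Pi.add_apply, ← show l t = log (exp t - 1) from rfl]
  rw [hE]
  field_simp
  ring

end
end
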